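/- Fix n ≥ 1 and let Γ = BS(n,−n) = ⟨a, b ∣ a bⁿ a^{-1} bⁿ⟩ be the Baumslag–Solitar group. Then Γ is weakly ucp stable: for every finite subset S ⊆ Γ and every ε > 0 there exist a finite subset T ⊆ Γ and δ > 0 such that for every m ≥ 1 and every ucp (T,δ)-representation φ : Γ → M_m(ℂ) there exist k ∈ ℕ, a unitary representation θ : Γ → M_k(ℂ), and a unitary representation π : Γ → M_{m+k}(ℂ) such that ‖(φ(s) ⊕ θ(s)) − π(s)‖ < ε for all s ∈ S. -/

import Mathlib

open scoped Matrix.Norms.L2Operator ComplexOrder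

noncomputable section

/-- The relator `a bⁿ a⁻¹ bⁿ` of the Baumslag–Solitar group `BS(n,−n)` in the free group on
two generators (`0` is `a`, `1` is `b`). -/
def bsRelator' (n : ℕ) : FreeGroup (Fin 2) :=
  FreeGroup.of 0 * (FreeGroup.of 1) ^ n * (FreeGroup.of 0)⁻¹ * (FreeGroup.of 1) ^ n

/-- The Baumslag–Solitar group `BS(n,−n) = ⟨a, b ∣ a bⁿ a⁻¹ bⁿ⟩`. -/
abbrev BSnmn (n : ℕ) : Type := PresentedGroup ({bsRelator' n} : Set (FreeGroup (Fin 2)))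

/-- A `(T,δ)`-representation of `Γ` on `M_m(ℂ)` (operator norm): a unital map into the closed
unit ball that is `δ`-multiplicative on `T`. -/
def IsQuasiRep {Γ : Type*} [Group Γ] (T : Set Γ) (δ : ℝ) {m : ℕ}
    (φ : Γ → Matrix (Fin m) (Fin m) ℂ) : Prop :=
  φ 1 = 1 ∧ (∀ x, ‖φ x‖ ≤ 1) ∧ ∀ s ∈ T, ∀ t ∈ T, ‖φ s * φ t - φ (s * t)‖ < δ

/-- A map `φ : Γ → M_m(ℂ)` is unital completely positive if all matrices
`∑_{g,h∈F} conj (z g) * z h • φ (g⁻¹ h)` are positive semidefinite. -/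
def IsUcpQuasiRep {Γ : Type*} [Group Γ] {m : ℕ} (φ : Γ → Matrix (Fin m) (Fin m) ℂ) : Prop :=
  ∀ (F : Finset Γ) (z : Γ → ℂ),
    (∑ g ∈ F, ∑ h ∈ F, ((starRingEnd ℂ) (z g) * z h) • φ (g⁻¹ * h)).PosSemidef

/-- A unitary representation of `Γ` on `M_k(ℂ)`. -/
def IsUnitaryRep {Γ : Type*} [Group Γ] {k : ℕ} (θ : Γ → Matrix (Fin k) (Fin k) ℂ) : Prop :=
  θ 1 = 1 ∧ (∀ x y, θ (x * y) = θ x * θ y) ∧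
    ∀ x, θ x ∈ unitary (Matrix (Fin k) (Fin k) ℂ)

/-- Block sum of square matrices. -/
def blockSum {n k : ℕ} (x : Matrix (Fin n) (Fin n) ℂ) (y : Matrix (Fin k) (Fin k) ℂ) :
    Matrix (Fin (n + k)) (Fin (n + k)) ℂ :=
  Matrix.reindex finSumFinEquiv finSumFinEquiv (Matrix.fromBlocks x 0 0 y)

open Matrix

section MatrixNorms

variable {ι κ l : Type*} [Fintype ι] [DecidableEq ι] [Fintype κ] [DecidableEq κ]
  [Fintype l] [DecidableEq l]

/-- The block diagonal embedding as a star homomorphism. -/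
def blockDiagHom (ι κ : Type*) [Fintype ι] [DecidableEq ι] [Fintype κ] [DecidableEq κ] :
    Matrix ι ι ℂ × Matrix κ κ ℂ →⋆ₙₐ[ℂ] Matrix (ι ⊕ κ) (ι ⊕ κ) ℂ where
  toFun p := fromBlocks p.1 0 0 p.2
  map_smul' c p := by simp [fromBlocks_smul]
  map_zero' := by simp
  map_add' p q := by simp [fromBlocks_add]
  map_mul' p q := by simp [fromBlocks_multiply]
  map_star' p := by simp [star_eq_conjTranspose, fromBlocks_conjTranspose]

theorem norm_fromBlocks_diag_le {A : Matrix ι ι ℂ} {D : Matrix κ κ ℂ} {c : ℝ}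
    (hA : ‖A‖ ≤ c) (hD : ‖D‖ ≤ c) : ‖fromBlocks A 0 0 D‖ ≤ c :=
  (NonUnitalStarAlgHom.norm_apply_le (blockDiagHom ι κ) (A, D)).trans (max_le hA hD)

theorem fromBlocks_diag_sub (A A' : Matrix ι ι ℂ) (D D' : Matrix κ κ ℂ) :
    fromBlocks A 0 0 D - fromBlocks A' 0 0 D' = fromBlocks (A - A') 0 0 (D - D') := by
  ext (i | i) (j | j) <;> simp

/-- Reindexing as a star homomorphism. -/
def reindexHom (e : ι ≃ κ) : Matrix ι ι ℂ →⋆ₙₐ[ℂ] Matrix κ κ ℂ where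
  toFun A := A.submatrix e.symm e.symm
  map_smul' c p := by simp [submatrix_smul]
  map_zero' := by simp
  map_add' p q := by simp [submatrix_add]
  map_mul' p q := by simp [submatrix_mul_equiv]
  map_star' p := by simp [star_eq_conjTranspose]

theorem norm_submatrix_le (e : ι ≃ κ) (A : Matrix ι ι ℂ) : ‖A.submatrix e.symm e.symm‖ ≤ ‖A‖ :=
  NonUnitalStarAlgHom.norm_apply_le (reindexHom e) A

theorem norm_diagonal_le {v : ι → ℂ} {c : ℝ} (hc : 0 ≤ c) (h : ∀ i, ‖v i‖ ≤ c) :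
    ‖diagonal v‖ ≤ c := by
  rw [l2_opNorm_diagonal]
  exact (pi_norm_le_iff_of_nonneg hc).2 h

theorem norm_one_matrix_le : ‖(1 : Matrix ι ι ℂ)‖ ≤ 1 := by
  rw [← diagonal_one]
  exact norm_diagonal_le zero_le_one (by simp)

theorem norm_le_one_of_isometry {V : Matrix ι κ ℂ} (h : Vᴴ * V = 1) : ‖V‖ ≤ 1 := by
  have h1 := l2_opNorm_conjTranspose_mul_self V
  rw [h] at h1
  have h2 : ‖(1 : Matrix κ κ ℂ)‖ ≤ 1 := norm_one_matrix_le
  nlinarith [norm_nonneg V]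

theorem norm_mul_le_left {A : Matrix ι κ ℂ} (hA : ‖A‖ ≤ 1) (B : Matrix κ l ℂ) :
    ‖A * B‖ ≤ ‖B‖ :=
  (l2_opNorm_mul A B).trans (by nlinarith [norm_nonneg B])

theorem norm_mul_le_right {B : Matrix κ l ℂ} (A : Matrix ι κ ℂ) (hB : ‖B‖ ≤ 1) :
    ‖A * B‖ ≤ ‖A‖ :=
  (l2_opNorm_mul A B).trans (by nlinarith [norm_nonneg A])

theorem norm_unitary_le {U : Matrix ι ι ℂ} (hU : U ∈ unitary (Matrix ι ι ℂ)) : ‖U‖ ≤ 1 :=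
  norm_le_one_of_isometry (Unitary.star_mul_self_of_mem hU)

theorem norm_star_unitary_le {U : Matrix ι ι ℂ} (hU : U ∈ unitary (Matrix ι ι ℂ)) : ‖Uᴴ‖ ≤ 1 :=
  norm_unitary_le (Unitary.star_mem hU)

theorem mem_unitary_of_star_mul_self {U : Matrix ι ι ℂ} (h : Uᴴ * U = 1) :
    U ∈ unitary (Matrix ι ι ℂ) :=
  Unitary.mem_iff.2 ⟨h, mul_eq_one_comm.1 h⟩

theorem diagonal_mem_unitary {v : ι → ℂ} (h : ∀ i, ‖v i‖ = 1) :
    diagonal v ∈ unitary (Matrix ι ι ℂ) := by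
  refine mem_unitary_of_star_mul_self ?_
  rw [diagonal_conjTranspose, diagonal_mul_diagonal, ← diagonal_one]
  congr 1
  ext i
  simp [← Complex.normSq_eq_conj_mul_self, Complex.normSq_eq_norm_sq, h i]

theorem fromBlocks_mem_unitary {A : Matrix ι ι ℂ} {D : Matrix κ κ ℂ}
    (hA : A ∈ unitary (Matrix ι ι ℂ)) (hD : D ∈ unitary (Matrix κ κ ℂ)) :
    fromBlocks A 0 0 D ∈ unitary (Matrix (ι ⊕ κ) (ι ⊕ κ) ℂ) := by
  have h1 : Aᴴ * A = 1 := Unitary.star_mul_self_of_mem hA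
  have h2 : Dᴴ * D = 1 := Unitary.star_mul_self_of_mem hD
  refine mem_unitary_of_star_mul_self ?_
  rw [fromBlocks_conjTranspose, fromBlocks_multiply]
  simp [h1, h2]

end MatrixNorms

section Polar

variable {ι : Type*} [Fintype ι] [DecidableEq ι]

/-- The unitary part of an almost unitary matrix is close to it, and anticommutes with whatever
self-adjoint matrix it anticommutes with. -/
theorem exists_unitary_near (X s : Matrix ι ι ℂ) (hs : sᴴ = s) (hX : ‖Xᴴ * X - 1‖ ≤ 1 / 2)
    (hsX : s * X = -(X * s)) :
    ∃ Y ∈ unitary (Matrix ι ι ℂ), ‖Y - X‖ ≤ ‖Xᴴ * X - 1‖ ∧ s * Y = -(Y * s) := by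
  set H : Matrix ι ι ℂ := Xᴴ * X with hH
  have hsa : IsSelfAdjoint H := IsSelfAdjoint.star_mul_self X
  have hsp : ∀ t ∈ spectrum ℝ H, |t - 1| ≤ ‖H - 1‖ := by
    intro t ht
    have h1 : t - 1 ∈ spectrum ℝ (H - 1) := by
      have := spectrum.sub_singleton_eq H (1 : ℝ)
      rw [map_one] at this
      rw [← this]
      exact Set.sub_mem_sub ht rfl
    have := spectrum.norm_le_norm_mul_of_mem h1
    refine this.trans ?_
    have h3 : ‖(1 : Matrix ι ι ℂ)‖ ≤ 1 := norm_one_matrix_le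
    nlinarith [norm_nonneg (H - 1)]
  have hpos : ∀ t ∈ spectrum ℝ H, 0 < t := by
    intro t ht
    have := abs_le.1 ((hsp t ht).trans hX)
    linarith [this.1]
  set G : Matrix ι ι ℂ := cfc (fun t : ℝ => (√t)⁻¹) H with hG
  have hc : ContinuousOn (fun t : ℝ => (√t)⁻¹) (spectrum ℝ H) :=
    ContinuousOn.inv₀ (Real.continuous_sqrt.continuousOn)
      fun t ht => (Real.sqrt_pos.2 (hpos t ht)).ne'
  have hGsa : IsSelfAdjoint G := cfc_predicate _ H
  have hGHG : G * H * G = 1 := by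
    have h1 : G * H * G = cfc (fun t : ℝ => (√t)⁻¹ * t * (√t)⁻¹) H := by
      rw [cfc_mul _ _ H (by fun_prop) hc, cfc_mul _ _ H hc (by fun_prop), cfc_id' ℝ H]
    rw [h1, ← cfc_one ℝ H]
    refine cfc_congr fun t ht => ?_
    have h2 := hpos t ht
    have h3 := Real.sqrt_pos.2 h2
    have h4 := Real.mul_self_sqrt h2.le
    simp only [Pi.one_apply]
    field_simp
    linarith
  have hY : X * G ∈ unitary (Matrix ι ι ℂ) := by
    refine mem_unitary_of_star_mul_self ?_
    rw [conjTranspose_mul, show Gᴴ = G from hGsa, ← hGHG, hH]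
    simp only [Matrix.mul_assoc]
  refine ⟨X * G, hY, ?_, ?_⟩
  · have h1 : X * G - X = X * G * (1 - cfc (fun t : ℝ => √t) H) := by
      have : G * cfc (fun t : ℝ => √t) H = 1 := by
        rw [hG, ← cfc_mul _ _ H hc (by fun_prop), ← cfc_one ℝ H]
        refine cfc_congr fun t ht => ?_
        exact inv_mul_cancel₀ (Real.sqrt_pos.2 (hpos t ht)).ne'
      rw [mul_sub, mul_one, Matrix.mul_assoc, this, mul_one]
    rw [h1]
    refine (norm_mul_le_left (norm_unitary_le hY) _).trans ?_
    have h2 : 1 - cfc (fun t : ℝ => √t) H = cfc (fun t : ℝ => 1 - √t) H := by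
      rw [cfc_sub _ _ H (by fun_prop) (by fun_prop), cfc_const_one ℝ H]
    rw [h2]
    refine norm_cfc_le (norm_nonneg _) fun t ht => le_trans ?_ (hsp t ht)
    have h3 := Real.mul_self_sqrt (hpos t ht).le
    have h4 : t - 1 = -((1 - √t) * (1 + √t)) := by linarith
    rw [h4, abs_neg, abs_mul, Real.norm_eq_abs]
    have h5 := Real.sqrt_nonneg t
    rw [abs_of_nonneg (show 0 ≤ 1 + √t by linarith)]
    nlinarith [abs_nonneg (1 - √t)]
  · have h1 : Xᴴ * s = -(s * Xᴴ) := by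
      have := congrArg conjTranspose hsX
      simpa [conjTranspose_mul, hs] using this
    have h2 : Commute H s := by
      change Xᴴ * X * s = s * (Xᴴ * X)
      have h3 : X * s = -(s * X) := by rw [hsX, neg_neg]
      rw [Matrix.mul_assoc, h3, Matrix.mul_neg, ← Matrix.mul_assoc, h1, neg_mul, neg_neg,
        Matrix.mul_assoc]
    have h3 : Commute G s := h2.cfc_real _
    rw [← Matrix.mul_assoc, hsX, neg_mul, Matrix.mul_assoc, Matrix.mul_assoc, h3.eq]

end Polar

section Flip

/-- Conjugation on the unit circle. -/
def circleConj (z : Metric.sphere (0 : ℂ) 1) : Metric.sphere (0 : ℂ) 1 :=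
  ⟨star z.1, by simp⟩

/-- The defect of `A` from intertwining `f u` and `f ū`. -/
def flipDefect {ι : Type} [Fintype ι] [DecidableEq ι] (f : Metric.sphere (0 : ℂ) 1 → ℂ)
    (A : Matrix ι ι ℂ) (u : ι → Metric.sphere (0 : ℂ) 1) : Matrix ι ι ℂ :=
  A * diagonal (fun i => f (u i)) - diagonal (fun i => f (circleConj (u i))) * A

theorem exists_delta_flipDefect (f : C(Metric.sphere (0 : ℂ) 1, ℂ)) :
    ∀ ε > 0, ∃ δ > 0, ∀ (ι : Type) [Fintype ι] [DecidableEq ι] (A : Matrix ι ι ℂ)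
      (u : ι → Metric.sphere (0 : ℂ) 1), ‖A‖ ≤ 1 → ‖flipDefect (fun z => z.1) A u‖ ≤ δ →
        ‖flipDefect f A u‖ ≤ ε := by
  induction f using ContinuousMap.induction_on_of_compact (𝕜 := ℂ) with
  | const r =>
    intro ε hε
    refine ⟨1, one_pos, fun ι _ _ A u hA h => ?_⟩
    have : flipDefect (ContinuousMap.const _ r) A u = 0 := by
      ext i j
      simp [flipDefect, mul_diagonal, diagonal_mul, mul_comm]
    rw [this, norm_zero]
    exact hε.le
  | id =>
    intro ε hε
    exact ⟨ε, hε, fun ι _ _ A u hA h => h⟩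
  | star_id =>
    intro ε hε
    refine ⟨ε, hε, fun ι _ _ A u hA h => ?_⟩
    have hu : ∀ i, ‖(u i).1‖ = 1 := fun i => by simp
    have h1 : ∀ i, ‖star (u i).1‖ = 1 := fun i => by rw [norm_star, hu i]
    have key : flipDefect (fun z => star z.1) A u =
        -(diagonal (fun i => (u i).1) * flipDefect (fun z => z.1) A u *
          diagonal (fun i => star (u i).1)) := by
      have h2 : ∀ i, (u i).1 * star (u i).1 = 1 := fun i => by
        rw [Complex.star_def, Complex.mul_conj, Complex.normSq_eq_norm_sq, hu i]; simp
      ext i j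
      simp only [flipDefect, circleConj, Matrix.mul_sub, Matrix.sub_mul, Matrix.sub_apply,
        Matrix.neg_apply,
        diagonal_mul, mul_diagonal, star_star]
      linear_combination ((u i).1 * A i j) * h2 j - (A i j * star (u j).1) * h2 i
    change ‖flipDefect (fun z => star z.1) A u‖ ≤ ε
    rw [key, norm_neg]
    refine (norm_mul_le_right _ (norm_unitary_le (diagonal_mem_unitary h1))).trans ?_
    exact (norm_mul_le_left (norm_unitary_le (diagonal_mem_unitary hu)) _).trans h
  | add f g hf hg =>
    intro ε hε
    obtain ⟨d1, h1, H1⟩ := hf (ε / 2) (by positivity)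
    obtain ⟨d2, h2, H2⟩ := hg (ε / 2) (by positivity)
    refine ⟨min d1 d2, lt_min h1 h2, fun ι _ _ A u hA h => ?_⟩
    have : flipDefect (f + g) A u = flipDefect f A u + flipDefect g A u := by
      ext i j
      simp [flipDefect, mul_diagonal, diagonal_mul]
      ring
    rw [ContinuousMap.coe_add, this]
    have := H1 ι A u hA (h.trans (min_le_left _ _))
    have := H2 ι A u hA (h.trans (min_le_right _ _))
    exact (norm_add_le _ _).trans (by linarith)
  | mul f g hf hg =>
    intro ε hε
    obtain ⟨d1, h1, H1⟩ := hf (ε / (2 * (‖g‖ + 1))) (by positivity)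
    obtain ⟨d2, h2, H2⟩ := hg (ε / (2 * (‖f‖ + 1))) (by positivity)
    refine ⟨min d1 d2, lt_min h1 h2, fun ι _ _ A u hA h => ?_⟩
    have : flipDefect (f * g) A u = flipDefect f A u * diagonal (fun i => g (u i)) +
        diagonal (fun i => f (circleConj (u i))) * flipDefect g A u := by
      ext i j
      simp [flipDefect, mul_diagonal, diagonal_mul, Matrix.mul_sub, Matrix.sub_mul]
      ring
    rw [ContinuousMap.coe_mul, this]
    have e1 := H1 ι A u hA (h.trans (min_le_left _ _))
    have e2 := H2 ι A u hA (h.trans (min_le_right _ _))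
    have n1 : ‖diagonal (fun i => g (u i))‖ ≤ ‖g‖ + 1 :=
      norm_diagonal_le (by positivity) fun i => (g.norm_coe_le_norm _).trans (by linarith)
    have n2 : ‖diagonal (fun i => f (circleConj (u i)))‖ ≤ ‖f‖ + 1 :=
      norm_diagonal_le (by positivity) fun i => (f.norm_coe_le_norm _).trans (by linarith)
    refine (norm_add_le _ _).trans ?_
    have m1 := (l2_opNorm_mul (flipDefect f A u) (diagonal (fun i => g (u i)))).trans
      (mul_le_mul e1 n1 (norm_nonneg _) (by positivity))
    have m2 := (l2_opNorm_mul (diagonal (fun i => f (circleConj (u i)))) (flipDefect g A u)).trans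
      (mul_le_mul n2 e2 (norm_nonneg _) (by positivity))
    have q1 : ε / (2 * (‖g‖ + 1)) * (‖g‖ + 1) = ε / 2 := by
      have : ‖g‖ + 1 ≠ 0 := by positivity
      field_simp
    have q2 : (‖f‖ + 1) * (ε / (2 * (‖f‖ + 1))) = ε / 2 := by
      have : ‖f‖ + 1 ≠ 0 := by positivity
      field_simp
    linarith
  | x_1 => infer_instance
  | frequently f h =>
    intro ε hε
    obtain ⟨g, hgf, hg⟩ :=
      (h.and_eventually (Metric.ball_mem_nhds f (show 0 < ε / 3 by positivity))).exists
    obtain ⟨δ, hδ, H⟩ := hgf (ε / 3) (by positivity)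
    refine ⟨δ, hδ, fun ι _ _ A u hA h => ?_⟩
    have e0 := H ι A u hA h
    have hfg : ‖f - g‖ ≤ ε / 3 := by
      rw [← dist_eq_norm, dist_comm]
      exact (Metric.mem_ball.1 hg).le
    have : flipDefect f A u = flipDefect g A u + (A * diagonal (fun i => (f - g) (u i))
        - diagonal (fun i => (f - g) (circleConj (u i))) * A) := by
      ext i j
      simp [flipDefect, mul_diagonal, diagonal_mul]
      ring
    rw [this]
    have n1 : ‖diagonal (fun i => (f - g) (u i))‖ ≤ ε / 3 :=
      norm_diagonal_le (by positivity) fun i => ((f - g).norm_coe_le_norm _).trans hfg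
    have n2 : ‖diagonal (fun i => (f - g) (circleConj (u i)))‖ ≤ ε / 3 :=
      norm_diagonal_le (by positivity) fun i => ((f - g).norm_coe_le_norm _).trans hfg
    have m1 := (norm_mul_le_left hA (diagonal (fun i => (f - g) (u i)))).trans n1
    have m2 := (norm_mul_le_right (diagonal (fun i => (f - g) (circleConj (u i)))) hA).trans n2
    refine (norm_add_le _ _).trans ?_
    have := norm_sub_le (A * diagonal (fun i => (f - g) (u i)))
      (diagonal (fun i => (f - g) (circleConj (u i))) * A)
    linarith

/-- A contraction which almost intertwines `u` and `ū` almost intertwines `F u` and `F ū`. -/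
theorem exists_delta_flip {F : ℂ → ℂ} (hF : Continuous F) {ε : ℝ} (hε : 0 < ε) :
    ∃ δ > 0, ∀ (ι : Type) [Fintype ι] [DecidableEq ι] (A : Matrix ι ι ℂ) (u : ι → ℂ),
      ‖A‖ ≤ 1 → (∀ i, ‖u i‖ = 1) → ‖A * diagonal u - diagonal (fun i => star (u i)) * A‖ ≤ δ →
        ‖A * diagonal (fun i => F (u i)) - diagonal (fun i => F (star (u i))) * A‖ ≤ ε := by
  obtain ⟨δ, hδ, H⟩ := exists_delta_flipDefect ⟨fun z => F z.1, by fun_prop⟩ ε hε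
  exact ⟨δ, hδ, fun ι _ _ A u hA hu h => H ι A (fun i => ⟨u i, by simpa using hu i⟩) hA h⟩

end Flip

section NearRep

/-- A pair of unitaries satisfying the relation of `BS(n,−n)`. -/
def IsExactPair (n : ℕ) {ι : Type} [Fintype ι] [DecidableEq ι] (A B : Matrix ι ι ℂ) : Prop :=
  A ∈ unitary (Matrix ι ι ℂ) ∧ B ∈ unitary (Matrix ι ι ℂ) ∧ A * B ^ n = Bᴴ ^ n * A

/-- The pair `A, B` is within `ε` of an exact pair, after adding an exact pair. -/
def NearRep (n : ℕ) (ε : ℝ) {ι : Type} [Fintype ι] [DecidableEq ι] (A B : Matrix ι ι ℂ) : Prop :=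
  ∃ (κ : Type) (_ : Fintype κ) (_ : DecidableEq κ) (A₁ B₁ : Matrix κ κ ℂ)
    (A₂ B₂ : Matrix (ι ⊕ κ) (ι ⊕ κ) ℂ), IsExactPair n A₁ B₁ ∧ IsExactPair n A₂ B₂ ∧
      ‖fromBlocks A 0 0 A₁ - A₂‖ ≤ ε ∧ ‖fromBlocks B 0 0 B₁ - B₂‖ ≤ ε

variable {n : ℕ} {ε : ℝ} {ι κ : Type} [Fintype ι] [DecidableEq ι] [Fintype κ] [DecidableEq κ]

theorem fromBlocks_diag_pow (A : Matrix ι ι ℂ) (D : Matrix κ κ ℂ) (n : ℕ) :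
    fromBlocks A 0 0 D ^ n = fromBlocks (A ^ n) 0 0 (D ^ n) := by
  induction n with
  | zero => simp
  | succ k ih => rw [pow_succ, ih, fromBlocks_multiply, pow_succ, pow_succ]; simp

theorem IsExactPair.sum {A B : Matrix ι ι ℂ} {A' B' : Matrix κ κ ℂ}
    (h : IsExactPair n A B) (h' : IsExactPair n A' B') :
    IsExactPair n (fromBlocks A 0 0 A') (fromBlocks B 0 0 B') := by
  refine ⟨fromBlocks_mem_unitary h.1 h'.1, fromBlocks_mem_unitary h.2.1 h'.2.1, ?_⟩
  rw [fromBlocks_conjTranspose, conjTranspose_zero, conjTranspose_zero, fromBlocks_diag_pow,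
    fromBlocks_diag_pow, fromBlocks_multiply, fromBlocks_multiply]
  simp [h.2.2, h'.2.2]

theorem conj_pow_of_isometry {W : Matrix ι κ ℂ} (h' : W * Wᴴ = 1) (hW : Wᴴ * W = 1)
    (B : Matrix ι ι ℂ) (n : ℕ) : (Wᴴ * B * W) ^ n = Wᴴ * B ^ n * W := by
  induction n with
  | zero => simp [hW]
  | succ k ih =>
    rw [pow_succ, ih, pow_succ]
    calc Wᴴ * B ^ k * W * (Wᴴ * B * W) = Wᴴ * B ^ k * (W * Wᴴ) * B * W := by
          simp only [Matrix.mul_assoc]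
      _ = _ := by rw [h']; simp only [Matrix.mul_assoc, Matrix.one_mul]

theorem conj_mem_unitary {W : Matrix ι κ ℂ} (h' : W * Wᴴ = 1) (hW : Wᴴ * W = 1)
    {B : Matrix ι ι ℂ} (hB : B ∈ unitary (Matrix ι ι ℂ)) :
    Wᴴ * B * W ∈ unitary (Matrix κ κ ℂ) := by
  have hB1 : Bᴴ * B = 1 := Unitary.star_mul_self_of_mem hB
  refine mem_unitary_of_star_mul_self ?_
  simp only [conjTranspose_mul, conjTranspose_conjTranspose]
  calc Wᴴ * (Bᴴ * W) * (Wᴴ * B * W) = Wᴴ * (Bᴴ * (W * Wᴴ) * B) * W := by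
        simp only [Matrix.mul_assoc]
    _ = 1 := by rw [h', Matrix.mul_one, hB1, Matrix.mul_one, hW]

theorem IsExactPair.conj {A B : Matrix ι ι ℂ} (h : IsExactPair n A B) {W : Matrix ι κ ℂ}
    (h' : W * Wᴴ = 1) (hW : Wᴴ * W = 1) : IsExactPair n (Wᴴ * A * W) (Wᴴ * B * W) := by
  refine ⟨conj_mem_unitary h' hW h.1, conj_mem_unitary h' hW h.2.1, ?_⟩
  have h3 : (Wᴴ * B * W)ᴴ = Wᴴ * Bᴴ * W := by
    simp only [conjTranspose_mul, conjTranspose_conjTranspose, Matrix.mul_assoc]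
  rw [h3, conj_pow_of_isometry h' hW, conj_pow_of_isometry h' hW]
  calc Wᴴ * A * W * (Wᴴ * B ^ n * W) = Wᴴ * (A * (W * Wᴴ) * B ^ n) * W := by
        simp only [Matrix.mul_assoc]
    _ = Wᴴ * (Bᴴ ^ n * (W * Wᴴ) * A) * W := by rw [h', Matrix.mul_one, Matrix.mul_one, h.2.2]
    _ = _ := by simp only [Matrix.mul_assoc]

theorem submatrix_equiv_pow (e : ι ≃ κ) (B : Matrix ι ι ℂ) (n : ℕ) :
    B.submatrix e.symm e.symm ^ n = (B ^ n).submatrix e.symm e.symm := by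
  induction n with
  | zero => simp
  | succ k ih => rw [pow_succ, ih, submatrix_mul_equiv, pow_succ]

theorem submatrix_equiv_sub (e : ι ≃ κ) (A B : Matrix ι ι ℂ) :
    (A - B).submatrix e.symm e.symm = A.submatrix e.symm e.symm - B.submatrix e.symm e.symm :=
  rfl

theorem submatrix_mem_unitary (e : ι ≃ κ) {B : Matrix ι ι ℂ} (hB : B ∈ unitary (Matrix ι ι ℂ)) :
    B.submatrix e.symm e.symm ∈ unitary (Matrix κ κ ℂ) := by
  have hB1 : Bᴴ * B = 1 := Unitary.star_mul_self_of_mem hB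
  refine mem_unitary_of_star_mul_self ?_
  rw [conjTranspose_submatrix, submatrix_mul_equiv, hB1, submatrix_one_equiv]

theorem IsExactPair.submatrix {A B : Matrix ι ι ℂ} (h : IsExactPair n A B) (e : ι ≃ κ) :
    IsExactPair n (A.submatrix e.symm e.symm) (B.submatrix e.symm e.symm) := by
  refine ⟨submatrix_mem_unitary e h.1, submatrix_mem_unitary e h.2.1, ?_⟩
  rw [conjTranspose_submatrix, submatrix_equiv_pow, submatrix_equiv_pow, submatrix_mul_equiv,
    submatrix_mul_equiv, h.2.2]

theorem NearRep.conj {A B : Matrix ι ι ℂ} (h : NearRep n ε A B) {W : Matrix ι κ ℂ}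
    (h' : W * Wᴴ = 1) (hW : Wᴴ * W = 1) : NearRep n ε (Wᴴ * A * W) (Wᴴ * B * W) := by
  obtain ⟨μ, _, _, A₁, B₁, A₂, B₂, h1, h2, hA, hB⟩ := h
  set V : Matrix (ι ⊕ μ) (κ ⊕ μ) ℂ := Matrix.fromBlocks W 0 0 1 with hV
  have hVV : V * Vᴴ = 1 := by
    rw [hV, fromBlocks_conjTranspose, fromBlocks_multiply]; simp [h']
  have hVV' : Vᴴ * V = 1 := by
    rw [hV, fromBlocks_conjTranspose, fromBlocks_multiply]; simp [hW]
  have key : ∀ (X : Matrix ι ι ℂ) (X₁ : Matrix μ μ ℂ) (X₂ : Matrix (ι ⊕ μ) (ι ⊕ μ) ℂ),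
      ‖Matrix.fromBlocks X 0 0 X₁ - X₂‖ ≤ ε →
      ‖Matrix.fromBlocks (Wᴴ * X * W) 0 0 X₁ - Vᴴ * X₂ * V‖ ≤ ε := by
    intro X X₁ X₂ hX
    have h3 : Matrix.fromBlocks (Wᴴ * X * W) 0 0 X₁ = Vᴴ * Matrix.fromBlocks X 0 0 X₁ * V := by
      rw [hV, fromBlocks_conjTranspose, fromBlocks_multiply, fromBlocks_multiply]; simp
    rw [h3, ← Matrix.sub_mul, ← Matrix.mul_sub]
    refine (norm_mul_le_right _ (norm_le_one_of_isometry hVV')).trans ?_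
    refine (norm_mul_le_left (norm_le_one_of_isometry ?_) _).trans hX
    rwa [conjTranspose_conjTranspose]
  exact ⟨μ, _, _, A₁, B₁, _, _, h1, h2.conj hVV hVV', key _ _ _ hA, key _ _ _ hB⟩

theorem NearRep.sum {A B : Matrix ι ι ℂ} {A' B' : Matrix κ κ ℂ}
    (h : NearRep n ε A B) (h' : NearRep n ε A' B') :
    NearRep n ε (fromBlocks A 0 0 A') (fromBlocks B 0 0 B') := by
  obtain ⟨μ, _, _, A₁, B₁, A₂, B₂, h1, h2, hA, hB⟩ := h
  obtain ⟨μ', _, _, A₁', B₁', A₂', B₂', h1', h2', hA', hB'⟩ := h'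
  set e := Equiv.sumSumSumComm ι μ κ μ' with he
  have key : ∀ (X : Matrix ι ι ℂ) (X₁ : Matrix μ μ ℂ) (X₂ : Matrix (ι ⊕ μ) (ι ⊕ μ) ℂ)
      (X' : Matrix κ κ ℂ) (X₁' : Matrix μ' μ' ℂ) (X₂' : Matrix (κ ⊕ μ') (κ ⊕ μ') ℂ),
      ‖Matrix.fromBlocks X 0 0 X₁ - X₂‖ ≤ ε → ‖Matrix.fromBlocks X' 0 0 X₁' - X₂'‖ ≤ ε →
      ‖Matrix.fromBlocks (Matrix.fromBlocks X 0 0 X') 0 0 (Matrix.fromBlocks X₁ 0 0 X₁') -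
        (Matrix.fromBlocks X₂ 0 0 X₂').submatrix e.symm e.symm‖ ≤ ε := by
    intro X X₁ X₂ X' X₁' X₂' hX hX'
    have h3 : Matrix.fromBlocks (Matrix.fromBlocks X 0 0 X') 0 0 (Matrix.fromBlocks X₁ 0 0 X₁') =
        (Matrix.fromBlocks (Matrix.fromBlocks X 0 0 X₁) 0 0
          (Matrix.fromBlocks X' 0 0 X₁')).submatrix e.symm e.symm := by
      ext ((i | i) | (i | i)) ((j | j) | (j | j)) <;> simp [he]
    rw [h3, ← submatrix_equiv_sub, fromBlocks_diag_sub]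
    exact (norm_submatrix_le e _).trans (norm_fromBlocks_diag_le hX hX')
  exact ⟨μ ⊕ μ', inferInstance, inferInstance, _, _, _, _, h1.sum h1',
    (h2.sum h2').submatrix e, key _ _ _ _ _ _ hA hA', key _ _ _ _ _ _ hB hB'⟩

theorem NearRep.cancel {A B : Matrix ι ι ℂ} {A' B' : Matrix κ κ ℂ} (h' : IsExactPair n A' B')
    (h : NearRep n ε (fromBlocks A 0 0 A') (fromBlocks B 0 0 B')) : NearRep n ε A B := by
  obtain ⟨μ, _, _, A₁, B₁, A₂, B₂, h1, h2, hA, hB⟩ := h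
  set e := Equiv.sumAssoc ι κ μ with he
  have key : ∀ (X : Matrix ι ι ℂ) (X' : Matrix κ κ ℂ) (X₁ : Matrix μ μ ℂ)
      (X₂ : Matrix ((ι ⊕ κ) ⊕ μ) ((ι ⊕ κ) ⊕ μ) ℂ),
      ‖Matrix.fromBlocks (Matrix.fromBlocks X 0 0 X') 0 0 X₁ - X₂‖ ≤ ε →
      ‖Matrix.fromBlocks X 0 0 (Matrix.fromBlocks X' 0 0 X₁) -
        X₂.submatrix e.symm e.symm‖ ≤ ε := by
    intro X X' X₁ X₂ hX
    have h3 : Matrix.fromBlocks X 0 0 (Matrix.fromBlocks X' 0 0 X₁) =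
        (Matrix.fromBlocks (Matrix.fromBlocks X 0 0 X') 0 0 X₁).submatrix e.symm e.symm := by
      ext (i | (i | i)) (j | (j | j)) <;> simp [he]
    rw [h3, ← submatrix_equiv_sub]
    exact (norm_submatrix_le e _).trans hX
  exact ⟨κ ⊕ μ, inferInstance, inferInstance, _, _, _, _, h'.sum h1, h2.submatrix e,
    key _ _ _ _ hA, key _ _ _ _ hB⟩

theorem NearRep.perturb {A B A' B' : Matrix ι ι ℂ} {ω : ℝ} (hω : 0 ≤ ω) (h : NearRep n ε A B)
    (hA' : ‖A' - A‖ ≤ ω) (hB' : ‖B' - B‖ ≤ ω) : NearRep n (ε + ω) A' B' := by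
  obtain ⟨μ, _, _, A₁, B₁, A₂, B₂, h1, h2, hA, hB⟩ := h
  have key : ∀ (X X' : Matrix ι ι ℂ) (X₁ : Matrix μ μ ℂ) (X₂ : Matrix (ι ⊕ μ) (ι ⊕ μ) ℂ),
      ‖Matrix.fromBlocks X 0 0 X₁ - X₂‖ ≤ ε → ‖X' - X‖ ≤ ω →
      ‖Matrix.fromBlocks X' 0 0 X₁ - X₂‖ ≤ ε + ω := by
    intro X X' X₁ X₂ hX hX'
    have h3 : Matrix.fromBlocks X' 0 0 X₁ - X₂ = (Matrix.fromBlocks X 0 0 X₁ - X₂) +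
        Matrix.fromBlocks (X' - X) 0 0 (0 : Matrix μ μ ℂ) := by
      have := fromBlocks_diag_sub X' X X₁ X₁
      rw [sub_self] at this
      rw [← this]; abel
    rw [h3]
    exact (norm_add_le _ _).trans
      (add_le_add hX (norm_fromBlocks_diag_le hX' (by rwa [norm_zero])))
  exact ⟨μ, _, _, A₁, B₁, _, _, h1, h2, key _ _ _ _ hA hA', key _ _ _ _ hB hB'⟩

theorem NearRep.mono {A B : Matrix ι ι ℂ} {ε' : ℝ} (h : NearRep n ε A B) (hε : ε ≤ ε') :
    NearRep n ε' A B := by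
  obtain ⟨μ, _, _, A₁, B₁, A₂, B₂, h1, h2, hA, hB⟩ := h
  exact ⟨μ, _, _, A₁, B₁, A₂, B₂, h1, h2, hA.trans hε, hB.trans hε⟩

theorem IsExactPair.nearRep {A B A' B' : Matrix ι ι ℂ} (h : IsExactPair n A' B')
    (hε : 0 ≤ ε) (hA : ‖A - A'‖ ≤ ε) (hB : ‖B - B'‖ ≤ ε) : NearRep n ε A B := by
  have h1 : IsExactPair n (1 : Matrix Empty Empty ℂ) 1 :=
    ⟨one_mem _, one_mem _, by simp⟩
  refine ⟨Empty, inferInstance, inferInstance, 1, 1, _, _, h1, h.sum h1, ?_, ?_⟩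
  · rw [fromBlocks_diag_sub]
    exact norm_fromBlocks_diag_le hA (by simpa using hε)
  · rw [fromBlocks_diag_sub]
    exact norm_fromBlocks_diag_le hB (by simpa using hε)

/-- `NearRep` holds with error `ε` for all almost exact pairs `A, β` with `β` diagonal and the
real part of `βⁿ` in `I`. -/
def Stab (n : ℕ) (ε : ℝ) (I : Set ℝ) : Prop :=
  ∃ δ > 0, ∀ (ι : Type) [Fintype ι] [DecidableEq ι] (β : ι → ℂ) (A : Matrix ι ι ℂ),
    A ∈ unitary (Matrix ι ι ℂ) → (∀ i, ‖β i‖ = 1) → (∀ i, (β i ^ n).re ∈ I) →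
    ‖A * diagonal (fun i => β i ^ n) - diagonal (fun i => star (β i ^ n)) * A‖ ≤ δ →
    NearRep n ε A (diagonal β)

theorem isExactPair_diagonal {A : Matrix ι ι ℂ} {β : ι → ℂ} (hA : A ∈ unitary (Matrix ι ι ℂ))
    (hβ : ∀ i, ‖β i‖ = 1)
    (h : A * diagonal (fun i => β i ^ n) = diagonal (fun i => star (β i ^ n)) * A) :
    IsExactPair n A (diagonal β) := by
  refine ⟨hA, diagonal_mem_unitary hβ, ?_⟩
  rw [diagonal_conjTranspose, diagonal_pow, diagonal_pow]
  simpa [Pi.pow_def, star_pow] using h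

end NearRep

section Root

/-- An `n`-th root of a unit complex number can be moved along with it. -/
theorem exists_root_near {n : ℕ} (hn : n ≠ 0) {ω : ℝ} (hω : 0 < ω) :
    ∃ ω' > 0, ∀ t b : ℂ, ‖t‖ = 1 → ‖b‖ = 1 → ‖t - b ^ n‖ < ω' →
      ∃ b' : ℂ, ‖b'‖ = 1 ∧ b' ^ n = t ∧ ‖b' - b‖ < ω := by
  have hc : ContinuousAt (fun z : ℂ => Complex.exp (Complex.log z / n)) 1 := by
    have := continuousAt_clog (x := 1) (by simp)
    fun_prop
  obtain ⟨ω', h0, H⟩ := Metric.continuousAt_iff.1 hc ω hω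
  refine ⟨ω', h0, fun t b ht hb htb => ?_⟩
  have hbn : b ^ n ≠ 0 := pow_ne_zero _ (norm_ne_zero_iff.1 (by rw [hb]; exact one_ne_zero))
  have ht0 : t ≠ 0 := norm_ne_zero_iff.1 (by rw [ht]; exact one_ne_zero)
  set r := Complex.exp (Complex.log (t / b ^ n) / n) with hr
  have hrn : r ^ n = t / b ^ n := by
    rw [hr, ← Complex.exp_nat_mul, mul_div_cancel₀ _ (by exact_mod_cast hn),
      Complex.exp_log (div_ne_zero ht0 hbn)]
  have hr1 : ‖r‖ = 1 := by
    have : ‖r‖ ^ n = 1 := by rw [← norm_pow, hrn, norm_div, ht, norm_pow, hb]; simp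
    exact (pow_eq_one_iff_of_nonneg (norm_nonneg _) hn).1 this
  refine ⟨b * r, by rw [norm_mul, hb, hr1, one_mul], ?_, ?_⟩
  · rw [mul_pow, hrn, mul_div_cancel₀ _ hbn]
  · have h1 : dist (t / b ^ n) 1 < ω' := by
      rw [dist_eq_norm, div_sub_one hbn, norm_div, norm_pow, hb]
      simpa using htb
    have := H h1
    rw [dist_eq_norm] at this
    rw [show b * r - b = b * (r - 1) by ring, norm_mul, hb, one_mul]
    simpa using this

end Root

section Half

/-- The sign encoded by a boolean. -/
def boolSign (b : Bool) : ℂ := if b then 1 else -1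

theorem boolSign_not (b : Bool) : boolSign (!b) = -boolSign b := by cases b <;> simp [boolSign]

theorem norm_boolSign (b : Bool) : ‖boolSign b‖ = 1 := by cases b <;> simp [boolSign]

theorem star_boolSign (b : Bool) : star (boolSign b) = boolSign b := by
  cases b <;> simp [boolSign]

theorem boolSign_mul_self (b : Bool) : boolSign b * boolSign b = 1 := by
  cases b <;> simp [boolSign]

/-- The unit complex number with real part `c` and imaginary part `± γ`. -/
def cutPoint (c γ : ℝ) (b : Bool) : ℂ := c + γ * boolSign b * Complex.I

theorem cutPoint_not (c γ : ℝ) (b : Bool) : cutPoint c γ (!b) = star (cutPoint c γ b) := by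
  cases b <;> simp [cutPoint, boolSign]

theorem cutPoint_re (c γ : ℝ) (b : Bool) : (cutPoint c γ b).re = c := by
  cases b <;> simp [cutPoint, boolSign]

theorem norm_cutPoint {c γ : ℝ} (h : c ^ 2 + γ ^ 2 = 1) (b : Bool) : ‖cutPoint c γ b‖ = 1 := by
  rw [← sq_eq_sq₀ (norm_nonneg _) zero_le_one, ← Complex.normSq_eq_norm_sq]
  cases b <;> simp [cutPoint, boolSign, Complex.normSq_apply] <;> linarith

variable {ι : Type} [Fintype ι] [DecidableEq ι]

/-- The coordinate projection of a predicate. -/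
def coordProj (p : ι → Prop) [DecidablePred p] : Matrix ι ι ℂ :=
  diagonal fun i => if p i then 1 else 0

/-- A self-adjoint matrix is diagonalised on the range of a coordinate projection by a unitary
commuting with that projection. -/
theorem exists_unitary_diagonalizing_compression (p : ι → Prop) [DecidablePred p]
    (T : Matrix ι ι ℂ) (hT : Tᴴ = T) :
    ∃ Q ∈ unitary (Matrix ι ι ℂ), ∃ l : ι → ℝ,
      Q * coordProj p = coordProj p ∧ coordProj p * Q = coordProj p ∧
      (1 - coordProj p) * T * (1 - coordProj p) * Q =
        Q * (1 - coordProj p) * diagonal (fun i => (l i : ℂ)) ∧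
      ∀ i, p i → l i = 0 := by
  set e := Equiv.sumCompl p with he
  set M : Matrix {i // ¬p i} {i // ¬p i} ℂ := T.submatrix Subtype.val Subtype.val with hM
  have hMh : M.IsHermitian := by
    rw [Matrix.IsHermitian, hM, conjTranspose_submatrix, hT]
  set q : Matrix {i // ¬p i} {i // ¬p i} ℂ :=
    (hMh.eigenvectorUnitary : Matrix {i // ¬p i} {i // ¬p i} ℂ) with hq
  have hqu : q ∈ unitary (Matrix {i // ¬p i} {i // ¬p i} ℂ) := hMh.eigenvectorUnitary.2
  have hMq : M * q = q * diagonal (fun i => (hMh.eigenvalues i : ℂ)) := by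
    have h1 := hMh.spectral_theorem
    have h2 : qᴴ * q = 1 := Unitary.star_mul_self_of_mem hqu
    have h3 : M = q * diagonal (fun i => (hMh.eigenvalues i : ℂ)) * qᴴ := h1
    calc M * q = q * diagonal (fun i => (hMh.eigenvalues i : ℂ)) * qᴴ * q := congrArg (· * q) h3
      _ = _ := by rw [Matrix.mul_assoc, h2, Matrix.mul_one]
  set Q : Matrix ι ι ℂ := (fromBlocks 1 0 0 q).submatrix e.symm e.symm with hQ
  set l : ι → ℝ := fun i => Sum.elim (fun _ => 0) hMh.eigenvalues (e.symm i) with hl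
  have hP : coordProj p =
      (fromBlocks 1 0 0 0 : Matrix _ _ ℂ).submatrix e.symm e.symm := by
    have h0 : (diagonal (Sum.elim (fun _ : {i // p i} => (1 : ℂ)) (fun _ : {i // ¬p i} => 0))) =
        fromBlocks 1 0 0 0 := by
      rw [← fromBlocks_diagonal]; simp
    rw [← h0, submatrix_diagonal _ _ e.symm.injective, coordProj]
    congr 1
    ext i
    obtain ⟨j, rfl⟩ := e.surjective i
    rcases j with ⟨j, hj⟩ | ⟨j, hj⟩ <;> simp [e, hj]
  have hP' : 1 - coordProj p =
      (fromBlocks 0 0 0 1 : Matrix _ _ ℂ).submatrix e.symm e.symm := by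
    rw [hP, ← submatrix_one_equiv e.symm, ← submatrix_equiv_sub, ← fromBlocks_one,
      fromBlocks_diag_sub]
    simp
  have hTe : T = (T.submatrix e e).submatrix e.symm e.symm := by
    ext i j; simp
  have hd : diagonal (fun i => (l i : ℂ)) = (fromBlocks 0 0 0
      (diagonal (fun i => (hMh.eigenvalues i : ℂ)))).submatrix e.symm e.symm := by
    have h0 : (diagonal (Sum.elim (fun _ : {i // p i} => (0 : ℂ))
        (fun i => (hMh.eigenvalues i : ℂ)))) =
        fromBlocks 0 0 0 (diagonal (fun i => (hMh.eigenvalues i : ℂ))) := by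
      rw [← fromBlocks_diagonal]; simp
    rw [← h0, submatrix_diagonal _ _ e.symm.injective]
    congr 1
    ext i
    simp only [hl, Function.comp]
    rcases e.symm i with j | j <;> simp
  refine ⟨Q, submatrix_mem_unitary e (fromBlocks_mem_unitary (one_mem _) hqu), l, ?_, ?_, ?_, ?_⟩
  · rw [hP, hQ, submatrix_mul_equiv, fromBlocks_multiply]; simp
  · rw [hP, hQ, submatrix_mul_equiv, fromBlocks_multiply]; simp
  · have hTb : T.submatrix e e = fromBlocks (T.submatrix Subtype.val Subtype.val)
        (T.submatrix Subtype.val Subtype.val) (T.submatrix Subtype.val Subtype.val) M := by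
      ext (i | i) (j | j) <;> simp [e, M]
    rw [hP', hTe, hTb, hd, hQ]
    simp only [submatrix_mul_equiv, fromBlocks_multiply]
    simp [hMq]
  · intro i hi
    have : e.symm i = Sum.inl ⟨i, hi⟩ := by rw [Equiv.symm_apply_eq]; rfl
    simp [hl, this]

end Half

section HalfTwo

variable {ι : Type} [Fintype ι] [DecidableEq ι]

theorem one_sub_coordProj (p : ι → Prop) [DecidablePred p] :
    1 - coordProj p = (diagonal fun i => if p i then 0 else 1 : Matrix ι ι ℂ) := by
  rw [coordProj, ← diagonal_one, diagonal_sub]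
  congr 1; ext i; split_ifs <;> simp

theorem norm_coordProj_le (p : ι → Prop) [DecidablePred p] : ‖coordProj p‖ ≤ 1 :=
  norm_diagonal_le zero_le_one fun i => by split_ifs <;> simp

theorem norm_one_sub_coordProj_le (p : ι → Prop) [DecidablePred p] : ‖1 - coordProj p‖ ≤ 1 := by
  rw [one_sub_coordProj]
  exact norm_diagonal_le zero_le_one fun i => by split_ifs <;> simp

theorem abs_sub_sign_le {l γ τ : ℝ} (hγ : 0 < γ) (h : |l ^ 2 - γ ^ 2| ≤ τ) :
    ‖(l : ℂ) - γ * boolSign (decide (0 ≤ l))‖ ≤ τ / γ := by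
  rw [le_div_iff₀ hγ]
  by_cases hl : 0 ≤ l
  · have : (l : ℂ) - γ * boolSign (decide (0 ≤ l)) = ((l - γ : ℝ) : ℂ) := by
      simp [boolSign, hl]
    rw [this, Complex.norm_real, Real.norm_eq_abs]
    refine le_trans ?_ h
    rw [show l ^ 2 - γ ^ 2 = (l - γ) * (l + γ) by ring, abs_mul,
      abs_of_nonneg (a := l + γ) (by linarith)]
    nlinarith [abs_nonneg (l - γ)]
  · have : (l : ℂ) - γ * boolSign (decide (0 ≤ l)) = ((l + γ : ℝ) : ℂ) := by
      simp [boolSign, hl]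
    push Not at hl
    rw [this, Complex.norm_real, Real.norm_eq_abs]
    refine le_trans ?_ h
    rw [show l ^ 2 - γ ^ 2 = (l + γ) * (-(γ - l)) by ring, abs_mul, abs_neg,
      abs_of_nonneg (a := γ - l) (by linarith)]
    nlinarith [abs_nonneg (l + γ)]

theorem exists_diagonalized_flip {c γ τ : ℝ} (hγ : 0 < γ) (hcγ : c ^ 2 + γ ^ 2 = 1)
    {A : Matrix ι ι ℂ} (hA : A ∈ unitary (Matrix ι ι ℂ)) {u : ι → ℂ} (hu : ∀ i, ‖u i‖ = 1)
    (p : ι → Prop) [DecidablePred p]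
    (h1 : ‖(A * diagonal u - diagonal (fun i => star (u i)) * A) * coordProj p‖ ≤ τ)
    (h2 : ‖diagonal (fun i => ((u i).re - c : ℂ)) * A * (1 - coordProj p)‖ ≤ τ) :
    ∃ Q ∈ unitary (Matrix ι ι ℂ), ∃ s' : ι → Bool, Q * coordProj p = coordProj p ∧
      ‖A * Q * diagonal (fun i => if p i then u i else star (cutPoint c γ (s' i))) -
        diagonal (fun i => star (u i)) * (A * Q)‖ ≤ 3 * τ + 4 * τ / γ := by
  have hτ : 0 ≤ τ := (norm_nonneg _).trans h1
  set P := coordProj p with hP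
  set Du := diagonal u with hDu
  set Dv := diagonal (fun i => star (u i)) with hDv
  set Dy := diagonal (fun i => ((u i).im : ℂ)) with hDy
  set Dx := diagonal (fun i => ((u i).re - c : ℂ)) with hDx
  have hAA : Aᴴ * A = 1 := Unitary.star_mul_self_of_mem hA
  have hAA' : A * Aᴴ = 1 := Unitary.mul_star_self_of_mem hA
  have hA1 := norm_unitary_le hA
  have hAs1 := norm_star_unitary_le hA
  have hPP : P * P = P := by rw [hP, coordProj, diagonal_mul_diagonal]; simp
  have hPs : Pᴴ = P := by
    rw [hP, coordProj, diagonal_conjTranspose]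
    congr 1; ext i; simp only [Pi.star_apply]; split_ifs <;> simp
  have hPn : ‖P‖ ≤ 1 := norm_coordProj_le p
  have hRn : ‖1 - P‖ ≤ 1 := norm_one_sub_coordProj_le p
  have hre : ∀ i, |(u i).re| ≤ 1 := fun i => (Complex.abs_re_le_norm _).trans (hu i).le
  have him : ∀ i, |(u i).im| ≤ 1 := fun i => (Complex.abs_im_le_norm _).trans (hu i).le
  have hc1 : |c| ≤ 1 := abs_le_one_iff_mul_self_le_one.2 (by nlinarith)
  have hDyn : ‖Dy‖ ≤ 1 := norm_diagonal_le zero_le_one fun i => by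
    rw [Complex.norm_real]; exact him i
  have hDus : Du ∈ unitary (Matrix ι ι ℂ) := diagonal_mem_unitary hu
  have hDvs : Dv ∈ unitary (Matrix ι ι ℂ) :=
    diagonal_mem_unitary fun i => by rw [norm_star, hu]
  have hDyP : Dy * P = P * Dy := by
    rw [hDy, hP, coordProj, diagonal_mul_diagonal, diagonal_mul_diagonal]; simp
  have hDvu : Du * Dv = 1 := by
    rw [hDu, hDv, diagonal_mul_diagonal, ← diagonal_one]
    congr 1; ext i
    rw [Complex.star_def, Complex.mul_conj, Complex.normSq_eq_norm_sq, hu i]; simp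
  have hDuPc : P * Du = Du * P := by
    rw [hDu, hP, coordProj, diagonal_mul_diagonal, diagonal_mul_diagonal]; simp
  have hDuP : Du * P * Dv = P := by
    rw [← hDuPc, Matrix.mul_assoc, hDvu, Matrix.mul_one]
  have h3 : ‖Du * A * P - A * (P * Dv)‖ ≤ τ := by
    have : Du * A * P - A * (P * Dv) = Du * ((A * Du - Dv * A) * P) * Dv := by
      calc Du * A * P - A * (P * Dv) = Du * A * (Du * P * Dv) - (Du * Dv) * A * P * Dv := by
            rw [hDuP, hDvu, Matrix.one_mul, Matrix.mul_assoc A]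
        _ = _ := by simp only [Matrix.sub_mul, Matrix.mul_sub, Matrix.mul_assoc]
    rw [this]
    exact ((norm_mul_le_right _ (norm_unitary_le hDvs)).trans
      (norm_mul_le_left (norm_unitary_le hDus) _)).trans h1
  have hDyuv : Dy = (-Complex.I / 2) • (Du - Dv) := by
    rw [hDy, hDu, hDv, diagonal_sub, ← diagonal_smul]
    congr 1; ext i
    simp only [Pi.smul_apply, smul_eq_mul]
    apply Complex.ext <;> simp
    ring
  have h4 : ‖Dy * A * P + A * (P * Dy)‖ ≤ τ := by
    have hDvP : P * Dv = Dv * P := by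
      rw [hDv, hP, coordProj, diagonal_mul_diagonal, diagonal_mul_diagonal]; simp
    have : Dy * A * P + A * (P * Dy) = (-Complex.I / 2) • ((Du * A * P - A * (P * Dv)) +
        (A * Du - Dv * A) * P) := by
      rw [hDyuv]
      simp only [Matrix.mul_sub, Matrix.sub_mul, Matrix.smul_mul, Matrix.mul_smul, ← smul_add,
        hDvP, hDuPc, Matrix.mul_assoc]
      congr 1; abel
    rw [this, norm_smul]
    have : ‖-Complex.I / 2‖ = 1 / 2 := by simp
    rw [this]
    have := norm_add_le (Du * A * P - A * (P * Dv)) ((A * Du - Dv * A) * P)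
    linarith
  set T := Aᴴ * Dy * A with hT
  have hDyh : Dyᴴ = Dy := by
    rw [hDy, diagonal_conjTranspose]; congr 1; ext i; simp
  have hTh : Tᴴ = T := by
    rw [hT, conjTranspose_mul, conjTranspose_mul, hDyh, conjTranspose_conjTranspose,
      Matrix.mul_assoc]
  have hTn : ‖T‖ ≤ 1 := by
    rw [hT, Matrix.mul_assoc]
    exact (norm_mul_le_left hAs1 _).trans ((norm_mul_le_right _ hA1).trans hDyn)
  have h5 : ‖(1 - P) * T * P‖ ≤ τ := by
    have h0 : (1 - P) * P = 0 := by rw [Matrix.sub_mul, hPP, Matrix.one_mul, sub_self]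
    have : (1 - P) * T * P = (1 - P) * (Aᴴ * (Dy * A * P + A * (P * Dy))) := by
      rw [Matrix.mul_add, ← Matrix.mul_assoc Aᴴ A, hAA, Matrix.one_mul, Matrix.mul_add,
        ← Matrix.mul_assoc (1 - P) P, h0, Matrix.zero_mul, add_zero, hT]
      simp only [Matrix.mul_assoc]
    rw [this]
    exact ((norm_mul_le_left hRn _).trans (norm_mul_le_left hAs1 _)).trans h4
  have h6 : ‖P * T * (1 - P)‖ ≤ τ := by
    have : P * T * (1 - P) = ((1 - P) * T * P)ᴴ := by
      simp only [conjTranspose_mul, conjTranspose_sub, conjTranspose_one, hPs, hTh,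
        Matrix.mul_assoc]
    rw [this, l2_opNorm_conjTranspose]
    exact h5
  obtain ⟨Q, hQ, l, hQP, hPQ, hQT, hl⟩ := exists_unitary_diagonalizing_compression p T hTh
  rw [← hP] at hQP hPQ hQT
  have hQn := norm_unitary_le hQ
  have hQQ : Qᴴ * Q = 1 := Unitary.star_mul_self_of_mem hQ
  set Dl := diagonal (fun i => (l i : ℂ)) with hDl
  have hRDl : (1 - P) * Dl = Dl := by
    rw [hP, one_sub_coordProj, hDl, diagonal_mul_diagonal]
    congr 1; ext i
    split_ifs with h
    · simp [hl i h]
    · simp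
  have hQR : Q * (1 - P) = (1 - P) * Q := by
    rw [Matrix.mul_sub, Matrix.sub_mul, hQP, hPQ, Matrix.mul_one, Matrix.one_mul]
  set N := A * Q * (1 - P) with hN
  have hRR : (1 - P) * (1 - P) = 1 - P := by
    rw [Matrix.mul_sub, Matrix.sub_mul, Matrix.sub_mul, hPP]; simp
  have hNN : Nᴴ * N = 1 - P := by
    have hRs : (1 - P)ᴴ = 1 - P := by rw [conjTranspose_sub, conjTranspose_one, hPs]
    rw [hN, conjTranspose_mul, conjTranspose_mul, hRs]
    calc (1 - P) * (Qᴴ * Aᴴ) * (A * Q * (1 - P)) = (1 - P) * (Qᴴ * (Aᴴ * A) * Q) * (1 - P) := by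
          simp only [Matrix.mul_assoc]
      _ = _ := by rw [hAA, Matrix.mul_one, hQQ, Matrix.mul_one, hRR]
  have hNn : ‖N‖ ≤ 1 :=
    (norm_mul_le_right _ hRn).trans ((norm_mul_le_right _ hQn).trans hA1)
  have hNsn : ‖Nᴴ‖ ≤ 1 := by rwa [l2_opNorm_conjTranspose]
  have h7 : ‖Dy * N - N * Dl‖ ≤ τ := by
    have : Dy * N - N * Dl = A * (P * T * (1 - P)) * Q := by
      have e1 : Dy * N = A * T * (1 - P) * Q := by
        calc Dy * N = (A * Aᴴ) * Dy * A * (Q * (1 - P)) := by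
              rw [hAA', hN, Matrix.one_mul]; simp only [Matrix.mul_assoc]
          _ = _ := by rw [hQR, hT]; simp only [Matrix.mul_assoc]
      have e2 : N * Dl = A * ((1 - P) * T * (1 - P) * Q) := by
        rw [hQT, hN]; simp only [Matrix.mul_assoc]
      rw [e1, e2]
      simp only [Matrix.sub_mul, Matrix.mul_sub, Matrix.mul_assoc, Matrix.one_mul]
      abel
    rw [this]
    exact ((norm_mul_le_right _ hQn).trans (norm_mul_le_left hA1 _)).trans h6
  have h8 : ‖Dx * N‖ ≤ τ := by
    have : Dx * N = Dx * A * (1 - P) * Q := by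
      rw [hN, Matrix.mul_assoc A, hQR]; simp only [Matrix.mul_assoc]
    rw [this]
    exact (norm_mul_le_right _ hQn).trans h2
  have h9 : ‖Dl‖ ≤ 1 := by
    have : Dl = Qᴴ * ((1 - P) * T * (1 - P) * Q) := by
      rw [hQT, Matrix.mul_assoc Q, hRDl, ← Matrix.mul_assoc, hQQ, Matrix.one_mul]
    rw [this]
    exact (norm_mul_le_left (norm_star_unitary_le hQ) _).trans ((norm_mul_le_right _ hQn).trans
      ((norm_mul_le_right _ hRn).trans ((norm_mul_le_left hRn _).trans hTn)))
  have h10 : ‖N * (Dl * Dl) - ((γ : ℂ) ^ 2) • N‖ ≤ 4 * τ := by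
    set Dw := diagonal (fun i => ((u i).re + c : ℂ)) with hDw
    have hDwn : ‖Dw‖ ≤ 2 := norm_diagonal_le (by norm_num) fun i => by
      rw [← Complex.ofReal_add, Complex.norm_real, Real.norm_eq_abs]
      exact (abs_add_le _ _).trans (by linarith [hre i])
    have hsq : Dy * Dy = ((γ : ℂ) ^ 2) • (1 : Matrix ι ι ℂ) - Dw * Dx := by
      rw [hDy, hDw, hDx, diagonal_mul_diagonal, diagonal_mul_diagonal, ← diagonal_one,
        ← diagonal_smul, diagonal_sub]
      congr 1; ext i
      have e1 : (u i).re ^ 2 + (u i).im ^ 2 = 1 := by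
        have := Complex.normSq_eq_norm_sq (u i)
        rw [hu i, Complex.normSq_apply] at this
        linarith
      simp only [Pi.smul_apply, smul_eq_mul]
      norm_cast
      linarith
    have : N * (Dl * Dl) - ((γ : ℂ) ^ 2) • N =
        -(Dy * (Dy * N - N * Dl) + (Dy * N - N * Dl) * Dl + Dw * (Dx * N)) := by
      have e3 : Dy * (Dy * N) = ((γ : ℂ) ^ 2) • N - Dw * (Dx * N) := by
        rw [← Matrix.mul_assoc, hsq, Matrix.sub_mul, Matrix.smul_mul, Matrix.one_mul,
          Matrix.mul_assoc]
      rw [Matrix.mul_sub, e3]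
      simp only [Matrix.sub_mul, Matrix.mul_assoc]
      abel
    rw [this, norm_neg]
    have m1 := (norm_mul_le_left hDyn (Dy * N - N * Dl)).trans h7
    have m2 := (norm_mul_le_right (Dy * N - N * Dl) h9).trans h7
    have m3 := (l2_opNorm_mul Dw (Dx * N)).trans
      (mul_le_mul hDwn h8 (norm_nonneg _) (by norm_num))
    refine (norm_add_le _ _).trans ?_
    have := norm_add_le (Dy * (Dy * N - N * Dl)) ((Dy * N - N * Dl) * Dl)
    linarith
  have h11 : ∀ i, ¬p i → |l i ^ 2 - γ ^ 2| ≤ 4 * τ := by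
    intro i hi
    have e1 : Nᴴ * (N * (Dl * Dl) - ((γ : ℂ) ^ 2) • N) =
        diagonal fun i => (if p i then 0 else 1) * ((l i : ℂ) ^ 2 - γ ^ 2) := by
      rw [Matrix.mul_sub, Matrix.mul_smul, ← Matrix.mul_assoc, hNN, hP, one_sub_coordProj, hDl,
        diagonal_mul_diagonal, diagonal_mul_diagonal, ← diagonal_smul, diagonal_sub]
      congr 1; ext i
      simp only [Pi.smul_apply, smul_eq_mul]
      ring
    have e2 := (norm_mul_le_left hNsn (N * (Dl * Dl) - ((γ : ℂ) ^ 2) • N)).trans h10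
    rw [e1, l2_opNorm_diagonal] at e2
    have e3 := (norm_le_pi_norm
      (fun i => (if p i then 0 else 1) * ((l i : ℂ) ^ 2 - γ ^ 2)) i).trans e2
    simp only [hi, if_false, one_mul] at e3
    rw [← Real.norm_eq_abs, ← Complex.norm_real]
    push_cast
    exact e3
  set Dd := diagonal (fun i => if p i then 0 else
    ((l i : ℂ) - γ * boolSign (decide (0 ≤ l i)))) with hDd
  have hDdn : ‖Dd‖ ≤ 4 * τ / γ := norm_diagonal_le (by positivity) fun i => by
    split_ifs with h
    · rw [norm_zero]; positivity
    · exact abs_sub_sign_le hγ (h11 i h)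
  refine ⟨Q, hQ, fun i => decide (0 ≤ l i), hQP, ?_⟩
  set Dw := diagonal (fun i => if p i then u i else star (cutPoint c γ (decide (0 ≤ l i))))
    with hDw
  have hRw : (1 - P) * Dw = (1 - P) * ((c : ℂ) • 1 - Complex.I • (Dl - Dd)) := by
    rw [hP, one_sub_coordProj, hDw, hDl, hDd, diagonal_sub, ← diagonal_one, ← diagonal_smul,
      ← diagonal_smul, diagonal_sub, diagonal_mul_diagonal, diagonal_mul_diagonal]
    congr 1; ext i
    by_cases h : p i
    · simp [h]
    · simp only [h, if_false, one_mul, Pi.smul_apply, smul_eq_mul, ← cutPoint_not]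
      rw [cutPoint, boolSign_not]
      ring
  have hPw : P * Dw = Du * P := by
    rw [hP, coordProj, hDw, hDu, diagonal_mul_diagonal, diagonal_mul_diagonal]
    congr 1; ext i
    split_ifs <;> simp
  have hDvx : Dv = (c : ℂ) • 1 + Dx - Complex.I • Dy := by
    rw [hDv, hDx, hDy, ← diagonal_one, ← diagonal_smul, ← diagonal_smul, diagonal_add,
      diagonal_sub]
    congr 1; ext i
    simp only [Pi.smul_apply, smul_eq_mul]
    apply Complex.ext <;> simp
  have key : A * Q * Dw - Dv * (A * Q) = (A * Du - Dv * A) * P -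
      (Dx * N - Complex.I • (Dy * N - N * Dl) - Complex.I • (N * Dd)) := by
    have e1 : A * Q = A * P + N := by
      rw [hN, Matrix.mul_sub, Matrix.mul_one, Matrix.mul_assoc A Q P, hQP]
      abel
    have e2 : N = A * Q * (1 - P) := hN
    have e3 : N * Dw = (c : ℂ) • N - Complex.I • (N * Dl - N * Dd) := by
      have e4 : N * (1 - P) = N := by rw [e2, Matrix.mul_assoc, hRR]
      calc N * Dw = N * ((1 - P) * Dw) := by rw [← Matrix.mul_assoc, e4]
        _ = N * ((c : ℂ) • 1 - Complex.I • (Dl - Dd)) := by rw [hRw, ← Matrix.mul_assoc, e4]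
        _ = _ := by
          rw [Matrix.mul_sub, Matrix.mul_smul, Matrix.mul_smul, Matrix.mul_one, Matrix.mul_sub]
    have e5 : Dv * N = (c : ℂ) • N + Dx * N - Complex.I • (Dy * N) := by
      rw [hDvx, Matrix.sub_mul, Matrix.add_mul, Matrix.smul_mul, Matrix.smul_mul, Matrix.one_mul]
    rw [e1, Matrix.add_mul, Matrix.mul_add, Matrix.mul_assoc A P, hPw, e3, e5]
    simp only [Matrix.sub_mul, smul_sub, Matrix.mul_assoc]
    abel
  rw [key]
  have m1 : ‖Complex.I • (Dy * N - N * Dl)‖ ≤ τ := by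
    rw [norm_smul, Complex.norm_I, one_mul]; exact h7
  have m2 : ‖Complex.I • (N * Dd)‖ ≤ 4 * τ / γ := by
    rw [norm_smul, Complex.norm_I, one_mul]
    exact (norm_mul_le_left hNn _).trans hDdn
  have t1 := norm_sub_le ((A * Du - Dv * A) * P)
    (Dx * N - Complex.I • (Dy * N - N * Dl) - Complex.I • (N * Dd))
  have t2 := norm_sub_le (Dx * N - Complex.I • (Dy * N - N * Dl)) (Complex.I • (N * Dd))
  have t3 := norm_sub_le (Dx * N) (Complex.I • (Dy * N - N * Dl))
  linarith

end HalfTwo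

section HalfThree

variable {ι : Type} [Fintype ι] [DecidableEq ι]

/-- The involution exchanging an element of a subtype with its extra copy. -/
def copySwap (r : ι → Prop) [DecidablePred r] : Equiv.Perm (ι ⊕ {i // r i}) :=
  Function.Involutive.toPerm
    (fun x => match x with
      | Sum.inl i => if h : r i then Sum.inr ⟨i, h⟩ else Sum.inl i
      | Sum.inr z => Sum.inl z.1) (by
    rintro (i | ⟨i, hi⟩)
    · by_cases h : r i <;> simp [h]
    · simp [hi])

theorem copySwap_inl_of_not (r : ι → Prop) [DecidablePred r] {i : ι} (h : ¬r i) :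
    copySwap r (Sum.inl i) = Sum.inl i :=
  dif_neg h

theorem copySwap_inl (r : ι → Prop) [DecidablePred r] {i : ι} (h : r i) :
    copySwap r (Sum.inl i) = Sum.inr ⟨i, h⟩ :=
  dif_pos h

theorem copySwap_inr (r : ι → Prop) [DecidablePred r] (z : {i // r i}) :
    copySwap r (Sum.inr z) = Sum.inl z.1 :=
  rfl

theorem copySwap_copySwap (r : ι → Prop) [DecidablePred r] (x : ι ⊕ {i // r i}) :
    copySwap r (copySwap r x) = x :=
  Function.Involutive.toPerm_involutive _ x

/-- The matrix of a permutation. -/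
def permMatrix (e : Equiv.Perm ι) : Matrix ι ι ℂ := fun i j => if i = e j then 1 else 0

theorem permMatrix_mem_unitary (e : Equiv.Perm ι) :
    permMatrix e ∈ unitary (Matrix ι ι ℂ) := by
  refine mem_unitary_of_star_mul_self ?_
  ext i j
  simp [mul_apply, permMatrix, one_apply, eq_comm]

/-- A matrix which flips `u` except on the coordinates where `u` is one of the two points with
real part `c` extends to a unitary flipping an extension of `u`. -/
theorem exists_flip_extension {c γ τ : ℝ} (hγ : 0 < γ) (hcγ : c ^ 2 + γ ^ 2 = 1)
    {A : Matrix ι ι ℂ} (hA : A ∈ unitary (Matrix ι ι ℂ)) {u : ι → ℂ} (hu : ∀ i, ‖u i‖ = 1)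
    (p : ι → Prop) [DecidablePred p] (s : ι → Bool)
    (hs : ∀ i, ¬p i → u i = cutPoint c γ (s i))
    (h1 : ‖(A * diagonal u - diagonal (fun i => star (u i)) * A) * coordProj p‖ ≤ τ)
    (h2 : ‖diagonal (fun i => ((u i).re - c : ℂ)) * A * (1 - coordProj p)‖ ≤ τ) :
    ∃ (Z : Type) (_ : Fintype Z) (_ : DecidableEq Z) (t : Z → Bool) (a : Matrix (ι ⊕ Z) (ι ⊕ Z) ℂ),
      a ∈ unitary (Matrix (ι ⊕ Z) (ι ⊕ Z) ℂ) ∧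
      ‖a * diagonal (Sum.elim u fun z => cutPoint c γ (t z)) -
        diagonal (fun i => star (Sum.elim u (fun z => cutPoint c γ (t z)) i)) * a‖
          ≤ 3 * τ + 4 * τ / γ ∧
      ∀ f : ι → ℂ, (∀ i, ¬p i → f i = 0) →
        a * (fromRows (diagonal f) 0 : Matrix (ι ⊕ Z) ι ℂ) = fromRows (A * diagonal f) 0 := by
  have hτ : 0 ≤ τ := (norm_nonneg _).trans h1
  obtain ⟨Q, hQ, s', hQP, hest⟩ := exists_diagonalized_flip hγ hcγ hA hu p h1 h2
  set r : ι → Prop := fun i => ¬p i ∧ s i = s' i with hr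
  set t : {i // r i} → Bool := fun z => !s z.1 with ht
  set u' : ι ⊕ {i // r i} → ℂ := Sum.elim u fun z => cutPoint c γ (t z) with hu'
  set w : ι ⊕ {i // r i} → ℂ := fun x => u' (copySwap r x) with hw
  set B : Matrix (ι ⊕ {i // r i}) (ι ⊕ {i // r i}) ℂ := fromBlocks (A * Q) 0 0 1 with hB
  have hBu : B ∈ unitary _ := fromBlocks_mem_unitary (mul_mem hA hQ) (one_mem _)
  set E := permMatrix (copySwap r) with hE
  have hw1 : ∀ i, w (Sum.inl i) = if p i then u i else star (cutPoint c γ (s' i)) := by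
    intro i
    rw [hw]
    by_cases hi : r i
    · simp only [copySwap_inl r hi, hu', Sum.elim_inr, ht, if_neg hi.1, ← cutPoint_not, hi.2]
    · simp only [copySwap_inl_of_not r hi, hu', Sum.elim_inl]
      split_ifs with hp
      · rfl
      · have : s i = !s' i := by
          by_contra h
          exact hi ⟨hp, by simpa using h⟩
        rw [hs i hp, ← cutPoint_not, this]
  have hw2 : ∀ z, w (Sum.inr z) = star (u' (Sum.inr z)) := by
    intro z
    simp only [hw, copySwap_inr, hu', Sum.elim_inl, Sum.elim_inr, ht, ← cutPoint_not,
      Bool.not_not]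
    exact hs z.1 z.2.1
  have hEu : E * diagonal u' = diagonal w * E := by
    ext i j
    simp only [mul_diagonal, diagonal_mul, hE, permMatrix, hw]
    split_ifs with h
    · rw [h, copySwap_copySwap, mul_comm]
    · simp
  refine ⟨_, inferInstance, inferInstance, t, B * E, mul_mem hBu (permMatrix_mem_unitary _),
    ?_, ?_⟩
  · have e1 : B * E * diagonal u' - diagonal (fun i => star (u' i)) * (B * E) =
        (B * diagonal w - diagonal (fun i => star (u' i)) * B) * E := by
      rw [Matrix.mul_assoc, hEu]
      simp only [Matrix.sub_mul, Matrix.mul_assoc]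
    rw [e1]
    refine (norm_mul_le_right _ (norm_unitary_le (permMatrix_mem_unitary _))).trans ?_
    have e2 : B * diagonal w - diagonal (fun i => star (u' i)) * B =
        fromBlocks (A * Q * diagonal (fun i => if p i then u i else star (cutPoint c γ (s' i))) -
          diagonal (fun i => star (u i)) * (A * Q)) 0 0 0 := by
      ext (i | i) (j | j) <;>
        simp [hB, mul_diagonal, diagonal_mul, hw1, hw2, hu', one_apply]
      rw [sub_eq_zero]
      split_ifs with h
      · rw [h]
      · rfl
    rw [e2]
    exact norm_fromBlocks_diag_le hest (by rw [norm_zero]; positivity)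
  · intro f hf
    have hEf : E * (fromRows (diagonal f) 0 : Matrix (ι ⊕ {i // r i}) ι ℂ) =
        fromRows (diagonal f) 0 := by
      have h0 : fromRows (diagonal f) (0 : Matrix {i // r i} ι ℂ) =
          (1 : Matrix (ι ⊕ {i // r i}) (ι ⊕ {i // r i}) ℂ).submatrix id Sum.inl * diagonal f := by
        ext (i | i) j
        · simp only [fromRows_apply_inl, mul_diagonal, diagonal_apply, submatrix_apply, id,
            one_apply, Sum.inl.injEq, ite_mul, one_mul, zero_mul]
          split_ifs with h
          · rw [h]
          · rfl
        · simp [mul_diagonal, one_apply]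
      have h1 : E * (1 : Matrix (ι ⊕ {i // r i}) (ι ⊕ {i // r i}) ℂ).submatrix id Sum.inl =
          E.submatrix id Sum.inl := by
        ext i j; simp [mul_apply, one_apply]
      rw [h0, ← Matrix.mul_assoc, h1]
      ext i j
      simp only [mul_diagonal, submatrix_apply, id, hE, permMatrix, one_apply]
      by_cases hj : p j
      · rw [copySwap_inl_of_not r fun h => h.1 hj]
      · rw [hf j hj, mul_zero, mul_zero]
    have hQf : Q * diagonal f = diagonal f := by
      have : coordProj p * diagonal f = diagonal f := by
        rw [coordProj, diagonal_mul_diagonal]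
        congr 1; ext i
        by_cases hi : p i
        · simp [hi]
        · simp [hf i hi]
      rw [← this, ← Matrix.mul_assoc, hQP]
    rw [Matrix.mul_assoc, hEf, hB, fromBlocks_mul_fromRows, Matrix.mul_assoc, hQf]
    simp

end HalfThree

section Truncation

/-- `u` pushed to the left of the vertical line through `c`. -/
def truncLeft (c γ : ℝ) (z : ℂ) (b : Bool) : ℂ := if z.re ≤ c then z else cutPoint c γ b

/-- `u` pushed to the right of the vertical line through `c`. -/
def truncRight (c γ : ℝ) (z : ℂ) (b : Bool) : ℂ := if c ≤ z.re then z else cutPoint c γ b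

theorem norm_truncLeft {c γ : ℝ} (h : c ^ 2 + γ ^ 2 = 1) {z : ℂ} (hz : ‖z‖ = 1) (b : Bool) :
    ‖truncLeft c γ z b‖ = 1 := by
  rw [truncLeft]; split_ifs
  exacts [hz, norm_cutPoint h b]

theorem truncLeft_re (c γ : ℝ) (z : ℂ) (b : Bool) : (truncLeft c γ z b).re = min z.re c := by
  rw [truncLeft]; split_ifs with h
  · rw [min_eq_left h]
  · rw [cutPoint_re, min_eq_right (not_le.1 h).le]

theorem cutPoint_neg (c γ : ℝ) (b : Bool) : cutPoint (-c) γ (!b) = -cutPoint c γ b := by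
  rw [cutPoint, cutPoint, boolSign_not]; push_cast; ring

theorem truncLeft_neg (c γ : ℝ) (z : ℂ) (b : Bool) :
    truncLeft (-c) γ (-z) (!b) = -truncRight c γ z b := by
  rw [truncLeft, truncRight, cutPoint_neg, Complex.neg_re]
  simp only [neg_le_neg_iff]
  split_ifs <;> rfl

theorem im_sq_of_norm_eq_one {z : ℂ} (hz : ‖z‖ = 1) : z.im ^ 2 = 1 - z.re ^ 2 := by
  have := Complex.normSq_eq_norm_sq z
  rw [hz, Complex.normSq_apply] at this
  linarith

/-- A function of the real part which vanishes right of `d` and is one left of `k`. -/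
def cutoff (k d x : ℝ) : ℝ := max 0 (min 1 ((d - x) / (d - k)))

theorem continuous_cutoff (k d : ℝ) : Continuous (cutoff k d) := by
  unfold cutoff; fun_prop

theorem cutoff_of_le {k d x : ℝ} (hkd : k < d) (h : x ≤ k) : cutoff k d x = 1 := by
  have : 1 ≤ (d - x) / (d - k) := by rw [le_div_iff₀ (by linarith)]; linarith
  rw [cutoff, min_eq_left this, max_eq_right zero_le_one]

theorem cutoff_of_ge {k d x : ℝ} (hkd : k < d) (h : d ≤ x) : cutoff k d x = 0 := by
  have : (d - x) / (d - k) ≤ 0 := div_nonpos_of_nonpos_of_nonneg (by linarith) (by linarith)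
  rw [cutoff, max_eq_left ((min_le_right _ _).trans this)]

/-- A continuous function agreeing with `truncLeft` left of `d`. -/
def truncModel (c γ d : ℝ) (z : ℂ) : ℂ :=
  (min z.re c : ℝ) + (z.im * (γ / √(1 - max c (min z.re d) ^ 2)) : ℝ) * Complex.I

theorem truncModel_star (c γ d : ℝ) (z : ℂ) :
    truncModel c γ d (star z) = star (truncModel c γ d z) := by
  apply Complex.ext <;> simp [truncModel]

theorem one_sub_sq_pos_of_mem {c d x : ℝ} (hc : -1 < c) (hd : d < 1) (h1 : c ≤ x) (h2 : x ≤ d) :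
    0 < 1 - x ^ 2 := by nlinarith

theorem continuous_truncModel {c γ d : ℝ} (hc : -1 < c) (hcd : c < d) (hd : d < 1) :
    Continuous (truncModel c γ d) := by
  have h : ∀ z : ℂ, √(1 - max c (min z.re d) ^ 2) ≠ 0 := fun z =>
    (Real.sqrt_pos.2 (one_sub_sq_pos_of_mem hc hd (le_max_left _ _)
      (max_le hcd.le (min_le_right _ _)))).ne'
  have h2 : Continuous fun z : ℂ => γ / √(1 - max c (min z.re d) ^ 2) :=
    Continuous.div (by fun_prop) (by fun_prop) h
  unfold truncModel
  fun_prop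

theorem truncModel_eq {c γ d : ℝ} (hγ : 0 < γ) (hcγ : c ^ 2 + γ ^ 2 = 1) (hcd : c < d) (hd : d < 1)
    {z : ℂ} (hz : ‖z‖ = 1) {b : Bool} (hb : (z.im : ℂ) = |z.im| * boolSign b) (hzd : z.re ≤ d) :
    truncModel c γ d z = truncLeft c γ z b := by
  rw [truncLeft, truncModel, min_eq_left hzd]
  have hc : -1 < c := by nlinarith
  split_ifs with h
  · rw [min_eq_left h, max_eq_left h, show 1 - c ^ 2 = γ ^ 2 by linarith, Real.sqrt_sq hγ.le,
      div_self hγ.ne', mul_one]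
    apply Complex.ext <;> simp
  · have h' := (not_le.1 h).le
    rw [min_eq_right h', max_eq_right h', ← im_sq_of_norm_eq_one hz, Real.sqrt_sq_eq_abs, cutPoint]
    have h3 : |z.im| ≠ 0 := by
      rw [abs_ne_zero]
      intro h0
      have h4 := im_sq_of_norm_eq_one hz
      rw [h0] at h4
      have := one_sub_sq_pos_of_mem hc hd h' hzd
      linarith
    push_cast
    rw [hb]
    have h5 : ((|z.im| : ℝ) : ℂ) ≠ 0 := by exact_mod_cast h3
    field_simp

/-- A unitary almost flipping `u` can be truncated to one almost flipping an extension of the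
left truncation of `u`. -/
theorem exists_truncLeft_flip {c γ k d τ : ℝ} (hγ : 0 < γ) (hcγ : c ^ 2 + γ ^ 2 = 1) (hck : c < k)
    (hkd : k < d) (hd : d < 1) (hτ : 0 < τ) :
    ∃ δ > 0, ∀ (ι : Type) [Fintype ι] [DecidableEq ι] (A : Matrix ι ι ℂ) (u : ι → ℂ) (s : ι → Bool),
      A ∈ unitary (Matrix ι ι ℂ) → (∀ i, ‖u i‖ = 1) →
      (∀ i, ((u i).im : ℂ) = |(u i).im| * boolSign (s i)) →
      ‖A * diagonal u - diagonal (fun i => star (u i)) * A‖ ≤ δ →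
      ∃ (Z : Type) (_ : Fintype Z) (_ : DecidableEq Z) (t : Z → Bool)
        (a : Matrix (ι ⊕ Z) (ι ⊕ Z) ℂ), a ∈ unitary (Matrix (ι ⊕ Z) (ι ⊕ Z) ℂ) ∧
        ‖a * diagonal (Sum.elim (fun i => truncLeft c γ (u i) (s i)) fun z => cutPoint c γ (t z)) -
          diagonal (fun i => star (Sum.elim (fun i => truncLeft c γ (u i) (s i))
            (fun z => cutPoint c γ (t z)) i)) * a‖ ≤ τ ∧
        ∀ f : ι → ℂ, (∀ i, k < (u i).re → f i = 0) →
          a * (fromRows (diagonal f) 0 : Matrix (ι ⊕ Z) ι ℂ) = fromRows (A * diagonal f) 0 := by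
  classical
  have hc : -1 < c := by nlinarith
  have hcd : c < d := hck.trans hkd
  set τ₀ := τ / (2 * (3 + 4 / γ)) with hτ₀
  have hτ₀pos : 0 < τ₀ := by positivity
  obtain ⟨δ₁, hδ₁, H₁⟩ := exists_delta_flip
    (F := fun z => (cutoff k d z.re : ℂ) * truncModel c γ d z)
    (by have := continuous_cutoff k d
        have := continuous_truncModel (γ := γ) hc hcd hd
        fun_prop) hτ₀pos
  obtain ⟨δ₂, hδ₂, H₂⟩ := exists_delta_flip (F := fun z => (cutoff k d z.re : ℂ))
    (by have := continuous_cutoff k d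
        fun_prop) hτ₀pos
  obtain ⟨δ₃, hδ₃, H₃⟩ := exists_delta_flip (F := fun z => ((min z.re c : ℝ) - c : ℂ))
    (by fun_prop) hτ₀pos
  refine ⟨min δ₁ (min δ₂ δ₃), by positivity, fun ι _ _ A u s hA hu hs h => ?_⟩
  have hA1 := norm_unitary_le hA
  have e1 := H₁ ι A u hA1 hu (h.trans (min_le_left _ _))
  have e2 := H₂ ι A u hA1 hu (h.trans ((min_le_right _ _).trans (min_le_left _ _)))
  have e3 := H₃ ι A u hA1 hu (h.trans ((min_le_right _ _).trans (min_le_right _ _)))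
  simp only [truncModel_star] at e1
  simp only [Complex.star_def, Complex.conj_re] at e1 e2 e3
  set r : ι → ℂ := fun i => truncLeft c γ (u i) (s i) with hr
  have hrn : ∀ i, ‖r i‖ = 1 := fun i => norm_truncLeft hcγ (hu i) _
  have hcut : ∀ i, (cutoff k d (u i).re : ℂ) * truncModel c γ d (u i) =
      (cutoff k d (u i).re : ℂ) * r i := by
    intro i
    rcases le_or_gt (u i).re d with h1 | h1
    · rw [truncModel_eq hγ hcγ hcd hd (hu i) (hs i) h1]
    · rw [cutoff_of_ge hkd h1.le]; simp
  have hcut' : ∀ i, (cutoff k d (u i).re : ℂ) * (starRingEnd ℂ) (truncModel c γ d (u i)) =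
      (cutoff k d (u i).re : ℂ) * (starRingEnd ℂ) (r i) := by
    intro i
    have := congrArg (starRingEnd ℂ) (hcut i)
    simpa using this
  simp only [hcut, hcut'] at e1
  set p : ι → Prop := fun i => (u i).re ≤ k with hp
  set Dφ := diagonal (fun i => (cutoff k d (u i).re : ℂ)) with hDφ
  have hP1 := norm_coordProj_le p
  have hR1 := norm_one_sub_coordProj_le p
  have hφP : Dφ * coordProj p = coordProj p := by
    rw [hDφ, coordProj, diagonal_mul_diagonal]
    congr 1; ext i
    by_cases hi : p i
    · rw [cutoff_of_le hkd hi]; simp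
    · simp [hi]
  have h1 : ‖(A * diagonal r - diagonal (fun i => star (r i)) * A) * coordProj p‖ ≤ 2 * τ₀ := by
    have : (A * diagonal r - diagonal (fun i => star (r i)) * A) * coordProj p =
        (A * diagonal (fun i => (cutoff k d (u i).re : ℂ) * r i) -
          diagonal (fun i => (cutoff k d (u i).re : ℂ) * (starRingEnd ℂ) (r i)) * A) *
            coordProj p -
        diagonal (fun i => star (r i)) * (A * Dφ - Dφ * A) * coordProj p := by
      have q1 : diagonal (fun i => (cutoff k d (u i).re : ℂ) * r i) = diagonal r * Dφ := by
        rw [hDφ, diagonal_mul_diagonal]; congr 1; ext i; ring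
      have q2 : diagonal (fun i => (cutoff k d (u i).re : ℂ) * (starRingEnd ℂ) (r i)) =
          diagonal (fun i => star (r i)) * Dφ := by
        rw [hDφ, diagonal_mul_diagonal]; congr 1; ext i; rw [Complex.star_def]; ring
      rw [q1, q2]
      simp only [Matrix.sub_mul, Matrix.mul_sub, Matrix.mul_assoc, hφP]
      abel
    rw [this]
    have m1 := (norm_mul_le_right (A * diagonal (fun i => (cutoff k d (u i).re : ℂ) * r i) -
          diagonal (fun i => (cutoff k d (u i).re : ℂ) * (starRingEnd ℂ) (r i)) * A) hP1).trans e1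
    have m2 := ((norm_mul_le_right _ hP1).trans (norm_mul_le_left (norm_unitary_le
      (diagonal_mem_unitary (v := fun i => star (r i)) fun i => by rw [norm_star, hrn]))
        (A * Dφ - Dφ * A))).trans e2
    exact (norm_sub_le _ _).trans (by linarith)
  have h2 : ‖diagonal (fun i => ((r i).re - c : ℂ)) * A * (1 - coordProj p)‖ ≤ 2 * τ₀ := by
    have q1 : ∀ i, ((r i).re - c : ℂ) = ((min (u i).re c : ℝ) - c : ℂ) := fun i => by
      rw [hr, truncLeft_re]
    simp only [q1]
    set Dq := diagonal (fun i => ((min (u i).re c : ℝ) - c : ℂ)) with hDq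
    have q2 : Dq * (1 - coordProj p) = 0 := by
      rw [hDq, one_sub_coordProj, diagonal_mul_diagonal, ← diagonal_zero]
      congr 1; ext i
      by_cases hi : p i
      · simp [hi]
      · have : c ≤ (u i).re := hck.le.trans (not_le.1 hi).le
        rw [min_eq_right this]; simp
    have : Dq * A * (1 - coordProj p) = -((A * Dq - Dq * A) * (1 - coordProj p)) := by
      rw [Matrix.sub_mul, Matrix.mul_assoc A, q2, Matrix.mul_zero, zero_sub, neg_neg]
    rw [this, norm_neg]
    exact ((norm_mul_le_right _ hR1).trans e3).trans (by linarith)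
  obtain ⟨Z, i1, i2, t, a, ha, hflip, hf⟩ := exists_flip_extension hγ hcγ hA hrn p s
    (fun i hi => by
      have : ¬(u i).re ≤ c := fun h => hi (h.trans hck.le)
      simp only [hr, truncLeft, if_neg this]) h1 h2
  refine ⟨Z, i1, i2, t, a, ha, hflip.trans (le_of_eq ?_), fun f hf' => hf f fun i hi => ?_⟩
  · rw [hτ₀]; field_simp
  · exact hf' i (not_le.1 hi)

theorem exists_truncRight_flip {c γ k d τ : ℝ} (hγ : 0 < γ) (hcγ : c ^ 2 + γ ^ 2 = 1) (hck : k < c)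
    (hkd : d < k) (hd : -1 < d) (hτ : 0 < τ) :
    ∃ δ > 0, ∀ (ι : Type) [Fintype ι] [DecidableEq ι] (A : Matrix ι ι ℂ) (u : ι → ℂ) (s : ι → Bool),
      A ∈ unitary (Matrix ι ι ℂ) → (∀ i, ‖u i‖ = 1) →
      (∀ i, ((u i).im : ℂ) = |(u i).im| * boolSign (s i)) →
      ‖A * diagonal u - diagonal (fun i => star (u i)) * A‖ ≤ δ →
      ∃ (Z : Type) (_ : Fintype Z) (_ : DecidableEq Z) (t : Z → Bool)
        (a : Matrix (ι ⊕ Z) (ι ⊕ Z) ℂ), a ∈ unitary (Matrix (ι ⊕ Z) (ι ⊕ Z) ℂ) ∧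
        ‖a * diagonal (Sum.elim (fun i => truncRight c γ (u i) (s i)) fun z => cutPoint c γ (t z)) -
          diagonal (fun i => star (Sum.elim (fun i => truncRight c γ (u i) (s i))
            (fun z => cutPoint c γ (t z)) i)) * a‖ ≤ τ ∧
        ∀ f : ι → ℂ, (∀ i, (u i).re < k → f i = 0) →
          a * (fromRows (diagonal f) 0 : Matrix (ι ⊕ Z) ι ℂ) = fromRows (A * diagonal f) 0 := by
  obtain ⟨δ, hδ, H⟩ := exists_truncLeft_flip (c := -c) (k := -k) (d := -d) hγ
    (by rw [neg_sq]; exact hcγ) (neg_lt_neg hck) (neg_lt_neg hkd) (by linarith) hτ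
  refine ⟨δ, hδ, fun ι _ _ A u s hA hu hs h => ?_⟩
  have neg_flip : ∀ {κ : Type} [Fintype κ] [DecidableEq κ] (B : Matrix κ κ ℂ) (v : κ → ℂ),
      B * diagonal (fun i => -v i) - diagonal (fun i => star (-v i)) * B =
        -(B * diagonal v - diagonal (fun i => star (v i)) * B) := by
    intro κ _ _ B v
    ext i j
    simp only [Matrix.sub_apply, Matrix.neg_apply, mul_diagonal, diagonal_mul, star_neg]
    ring
  obtain ⟨Z, i1, i2, t, a, ha, hflip, hf⟩ := H ι A (fun i => -u i) (fun i => !s i) hA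
    (fun i => by rw [norm_neg, hu]) (fun i => by
      rw [Complex.neg_im, abs_neg, boolSign_not, Complex.ofReal_neg, hs i]; simp)
    (by rw [neg_flip, norm_neg]; exact h)
  refine ⟨Z, i1, i2, fun z => !t z, a, ha, ?_, fun f hf' => hf f fun i hi => hf' i ?_⟩
  · have : (Sum.elim (fun i => truncLeft (-c) γ (-u i) (!s i)) fun z => cutPoint (-c) γ (t z)) =
        fun i => -(Sum.elim (fun i => truncRight c γ (u i) (s i))
          (fun z => cutPoint c γ (!t z)) i) := by
      ext (i | z)
      · simp only [Sum.elim_inl, truncLeft_neg]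
      · simp only [Sum.elim_inr]
        rw [← cutPoint_neg, Bool.not_not]
    rw [this, neg_flip, norm_neg] at hflip
    exact hflip
  · rw [Complex.neg_re] at hi
    linarith

end Truncation

section Anticommute

variable {ι : Type} [Fintype ι] [DecidableEq ι]

/-- An almost unitary matrix almost anticommuting with a symmetry is close to a unitary
anticommuting with it. -/
theorem exists_anticommuting_near {X s : Matrix ι ι ℂ} {η κ : ℝ} (hs : sᴴ = s) (hss : s * s = 1)
    (hs1 : ‖s‖ ≤ 1) (hX1 : ‖X‖ ≤ 1) (hX : ‖Xᴴ * X - 1‖ ≤ η) (hsX : ‖X * s + s * X‖ ≤ 2 * κ)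
    (hsmall : η + 2 * κ ≤ 1 / 2) :
    ∃ Y ∈ unitary (Matrix ι ι ℂ), ‖Y - X‖ ≤ η + 3 * κ ∧ s * Y = -(Y * s) := by
  set X' : Matrix ι ι ℂ := (1 / 2 : ℂ) • (X - s * X * s) with hX'
  have d1 : ‖X' - X‖ ≤ κ := by
    have : X' - X = -((1 / 2 : ℂ) • ((X * s + s * X) * s)) := by
      rw [Matrix.add_mul, Matrix.mul_assoc X, hss, Matrix.mul_one, hX']
      module
    rw [this, norm_neg, norm_smul]
    have := (norm_mul_le_right (X * s + s * X) hs1).trans hsX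
    norm_num
    linarith
  have d2 : ‖X'‖ ≤ 1 := by
    have h1 : ‖s * X * s‖ ≤ 1 :=
      ((norm_mul_le_right _ hs1).trans (norm_mul_le_left hs1 X)).trans hX1
    have h2 := (norm_sub_le X (s * X * s)).trans (add_le_add hX1 h1)
    rw [hX', norm_smul]
    norm_num
    linarith
  have d3 : ‖X'ᴴ * X' - 1‖ ≤ η + 2 * κ := by
    have : X'ᴴ * X' - 1 = X'ᴴ * (X' - X) + (X' - X)ᴴ * X + (Xᴴ * X - 1) := by
      rw [conjTranspose_sub]
      simp only [Matrix.mul_sub, Matrix.sub_mul]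
      abel
    rw [this]
    have h1 := (norm_mul_le_left ((l2_opNorm_conjTranspose X').trans_le d2) (X' - X)).trans d1
    have h2 := ((norm_mul_le_right (X' - X)ᴴ hX1).trans_eq (l2_opNorm_conjTranspose _)).trans d1
    exact (norm_add₃_le).trans (by linarith)
  have d4 : s * X' = -(X' * s) := by
    rw [hX', Matrix.mul_smul, Matrix.smul_mul, Matrix.mul_sub, Matrix.sub_mul, ← smul_neg]
    congr 1
    simp only [Matrix.mul_assoc, hss, Matrix.mul_one]
    rw [← Matrix.mul_assoc s s, hss, Matrix.one_mul, neg_sub]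
  obtain ⟨Y, hY, h1, h2⟩ := exists_unitary_near X' s hs (d3.trans hsmall) d4
  refine ⟨Y, hY, ?_, h2⟩
  have := norm_sub_le_norm_sub_add_norm_sub Y X' X
  linarith

theorem boolDiagonal_mul_self (σ : ι → Bool) :
    diagonal (fun i => boolSign (σ i)) * diagonal (fun i => boolSign (σ i)) = 1 := by
  rw [diagonal_mul_diagonal, ← diagonal_one]
  simp only [boolSign_mul_self]

theorem boolDiagonal_conjTranspose (σ : ι → Bool) :
    (diagonal (fun i => boolSign (σ i)))ᴴ = diagonal (fun i => boolSign (σ i)) := by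
  rw [diagonal_conjTranspose]
  congr 1; ext i
  exact star_boolSign _

theorem norm_boolDiagonal_le (σ : ι → Bool) : ‖diagonal (fun i => boolSign (σ i))‖ ≤ 1 :=
  norm_diagonal_le zero_le_one fun _ => (norm_boolSign _).le

theorem star_cutPoint (c γ : ℝ) (b : Bool) : star (cutPoint c γ b) = cutPoint c γ (!b) := by
  rw [cutPoint, cutPoint, boolSign_not]
  cases b <;> simp [boolSign]

theorem mul_cutPoint_diagonal_sub (c γ : ℝ) (σ : ι → Bool) (X : Matrix ι ι ℂ) :
    X * diagonal (fun i => cutPoint c γ (σ i)) - diagonal (fun i => star (cutPoint c γ (σ i))) * X =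
      (γ * Complex.I : ℂ) • (X * diagonal (fun i => boolSign (σ i)) +
        diagonal (fun i => boolSign (σ i)) * X) := by
  ext i j
  simp only [Matrix.sub_apply, mul_diagonal, diagonal_mul, Matrix.smul_apply, Matrix.add_apply,
    star_cutPoint, smul_eq_mul]
  simp only [cutPoint, boolSign_not]
  ring

theorem mul_cutPoint_diagonal_eq (c γ : ℝ) {σ : ι → Bool} {X : Matrix ι ι ℂ}
    (h : diagonal (fun i => boolSign (σ i)) * X = -(X * diagonal (fun i => boolSign (σ i)))) :
    X * diagonal (fun i => cutPoint c γ (σ i)) =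
      diagonal (fun i => star (cutPoint c γ (σ i))) * X := by
  rw [← sub_eq_zero, mul_cutPoint_diagonal_sub, h, add_neg_cancel, smul_zero]

end Anticommute

section Split

variable {M E G : Type} [Fintype M] [DecidableEq M] [Fintype E] [DecidableEq E] [Fintype G]
  [DecidableEq G]

theorem norm_fromCols_le (P : Matrix M E ℂ) (Q : Matrix M G ℂ) :
    ‖fromCols P Q‖ ≤ ‖P‖ + ‖Q‖ := by
  have h1 : ‖(fromCols 1 0 : Matrix E (E ⊕ G) ℂ)‖ ≤ 1 := by
    rw [← l2_opNorm_conjTranspose]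
    refine norm_le_one_of_isometry ?_
    rw [conjTranspose_conjTranspose, conjTranspose_fromCols_eq_fromRows_conjTranspose,
      fromCols_mul_fromRows]
    simp
  have h2 : ‖(fromCols 0 1 : Matrix G (E ⊕ G) ℂ)‖ ≤ 1 := by
    rw [← l2_opNorm_conjTranspose]
    refine norm_le_one_of_isometry ?_
    rw [conjTranspose_conjTranspose, conjTranspose_fromCols_eq_fromRows_conjTranspose,
      fromCols_mul_fromRows]
    simp
  have : fromCols P Q = P * (fromCols 1 0 : Matrix E (E ⊕ G) ℂ) +
      Q * (fromCols 0 1 : Matrix G (E ⊕ G) ℂ) := by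
    rw [mul_fromCols, mul_fromCols]
    ext i (j | j) <;> simp
  rw [this]
  exact (norm_add_le _ _).trans (add_le_add (norm_mul_le_right _ h1) (norm_mul_le_right _ h2))

variable {V : Matrix M E ℂ} {V' : Matrix M G ℂ}

theorem norm_conj_sub_fromBlocks_le (hW : (fromCols V V')ᴴ * fromCols V V' = 1)
    (X : Matrix M M ℂ) (A : Matrix E E ℂ) (A' : Matrix G G ℂ) :
    ‖(fromCols V V')ᴴ * X * fromCols V V' - fromBlocks A 0 0 A'‖ ≤
      ‖X * V - V * A‖ + ‖X * V' - V' * A'‖ := by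
  have h1 : ‖(fromCols V V')ᴴ‖ ≤ 1 :=
    (l2_opNorm_conjTranspose _).trans_le (norm_le_one_of_isometry hW)
  have h2 : (fromCols V V')ᴴ * X * fromCols V V' - fromBlocks A 0 0 A' =
      (fromCols V V')ᴴ * fromCols (X * V - V * A) (X * V' - V' * A') := by
    have h3 : fromCols (X * V - V * A) (X * V' - V' * A') =
        X * fromCols V V' - fromCols V V' * fromBlocks A 0 0 A' := by
      rw [mul_fromCols, fromCols_mul_fromBlocks]
      ext i (j | j) <;> simp
    rw [h3, Matrix.mul_sub, ← Matrix.mul_assoc, ← Matrix.mul_assoc _ _ (fromBlocks A 0 0 A'), hW,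
      Matrix.one_mul]
  rw [h2]
  exact (norm_mul_le_left h1 _).trans (norm_fromCols_le _ _)

/-- The complementary corner of a unitary almost restricting to a unitary, corrected to
anticommute with a symmetry. -/
theorem exists_complement {c γ η τ ρ : ℝ} (hγ : 0 < γ)
    (hW : (fromCols V V')ᴴ * fromCols V V' = 1) (hW' : fromCols V V' * (fromCols V V')ᴴ = 1)
    {X : Matrix M M ℂ} (hX : X ∈ unitary (Matrix M M ℂ)) {A : Matrix E E ℂ}
    (hA : A ∈ unitary (Matrix E E ℂ)) (hη : η ≤ 1) (hXV : ‖X * V - V * A‖ ≤ η) {u : M → ℂ}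
    {σ : G → Bool} (hXu : ‖X * diagonal u - diagonal (fun i => star (u i)) * X‖ ≤ τ)
    (hu : ‖diagonal u * V' - V' * diagonal (fun i => cutPoint c γ (σ i))‖ ≤ ρ)
    (hsmall : η + (τ + 2 * ρ) / γ ≤ 1 / 2) :
    ∃ Y ∈ unitary (Matrix G G ℂ), ‖X * V' - V' * Y‖ ≤ 2 * η + 2 * ((τ + 2 * ρ) / γ) ∧
      Y * diagonal (fun i => cutPoint c γ (σ i)) =
        diagonal (fun i => star (cutPoint c γ (σ i))) * Y := by
  have hX1 : Xᴴ * X = 1 := Unitary.star_mul_self_of_mem hX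
  have hA1 : A * Aᴴ = 1 := Unitary.mul_star_self_of_mem hA
  have hXn := norm_unitary_le hX
  have hη0 : 0 ≤ η := (norm_nonneg _).trans hXV
  rw [conjTranspose_fromCols_eq_fromRows_conjTranspose, fromRows_mul_fromCols, ← fromBlocks_one,
    fromBlocks_inj] at hW
  rw [conjTranspose_fromCols_eq_fromRows_conjTranspose, fromCols_mul_fromRows] at hW'
  obtain ⟨w1, w2, w3, w4⟩ := hW
  have n1 := norm_le_one_of_isometry w1
  have n2 := norm_le_one_of_isometry w4
  have n2' : ‖V'ᴴ‖ ≤ 1 := (l2_opNorm_conjTranspose _).trans_le n2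
  have off : ‖Vᴴ * X * V'‖ ≤ η := by
    have : Vᴴ * X * V' = (-(Xᴴ * (X * V - V * A) * Aᴴ))ᴴ * V' := by
      have h1 : Xᴴ * (X * V - V * A) * Aᴴ = V * Aᴴ - Xᴴ * V := by
        rw [Matrix.mul_sub, ← Matrix.mul_assoc, hX1, Matrix.one_mul, Matrix.sub_mul,
          Matrix.mul_assoc, Matrix.mul_assoc, hA1, Matrix.mul_one]
      rw [h1, neg_sub, conjTranspose_sub, conjTranspose_mul, conjTranspose_mul,
        conjTranspose_conjTranspose, conjTranspose_conjTranspose, Matrix.sub_mul,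
        Matrix.mul_assoc A,
        w2, Matrix.mul_zero, sub_zero]
    rw [this]
    refine (norm_mul_le_right _ n2).trans ?_
    rw [l2_opNorm_conjTranspose, norm_neg]
    exact ((norm_mul_le_right _ (norm_star_unitary_le hA)).trans
      (norm_mul_le_left (norm_star_unitary_le hX) _)).trans hXV
  set X₁ : Matrix G G ℂ := V'ᴴ * X * V' with hX₁
  have hX₁n : ‖X₁‖ ≤ 1 := (norm_mul_le_right _ n2).trans ((norm_mul_le_left n2' _).trans hXn)
  have hsplit : X * V' - V' * X₁ = V * (Vᴴ * X * V') := by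
    have : X * V' = (V * Vᴴ + V' * V'ᴴ) * (X * V') := by rw [hW', Matrix.one_mul]
    rw [hX₁, this, Matrix.add_mul]
    simp only [Matrix.mul_assoc]
    abel
  have huni : ‖X₁ᴴ * X₁ - 1‖ ≤ η := by
    have : X₁ᴴ * X₁ - 1 = -((Vᴴ * X * V')ᴴ * (Vᴴ * X * V')) := by
      have e1 : V'ᴴ * Xᴴ * (V * Vᴴ + V' * V'ᴴ) * (X * V') = 1 := by
        rw [hW', Matrix.mul_one, Matrix.mul_assoc, ← Matrix.mul_assoc Xᴴ, hX1, Matrix.one_mul, w4]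
      rw [← e1, hX₁]
      simp only [conjTranspose_mul, conjTranspose_conjTranspose, Matrix.mul_add, Matrix.add_mul,
        Matrix.mul_assoc]
      abel
    rw [this, norm_neg]
    refine (norm_mul_le_left ((l2_opNorm_conjTranspose _).trans_le (off.trans hη)) _).trans off
  have hflip : ‖X₁ * diagonal (fun i => cutPoint c γ (σ i)) -
      diagonal (fun i => star (cutPoint c γ (σ i))) * X₁‖ ≤ τ + 2 * ρ := by
    set D := diagonal u
    set D' := diagonal (fun i => cutPoint c γ (σ i))
    have hD : diagonal (fun i => star (u i)) = Dᴴ := (diagonal_conjTranspose _).symm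
    have hD' : diagonal (fun i => star (cutPoint c γ (σ i))) = D'ᴴ :=
      (diagonal_conjTranspose _).symm
    rw [hD] at hXu
    rw [hD']
    have : X₁ * D' - D'ᴴ * X₁ = V'ᴴ * (X * D - Dᴴ * X) * V' - V'ᴴ * X * (D * V' - V' * D') +
        (D * V' - V' * D')ᴴ * (X * V') := by
      simp only [hX₁, conjTranspose_sub, conjTranspose_mul, Matrix.mul_sub, Matrix.sub_mul,
        Matrix.mul_assoc]
      abel
    rw [this]
    have h1 := ((norm_mul_le_right (V'ᴴ * (X * D - Dᴴ * X)) n2).trans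
      (norm_mul_le_left n2' _)).trans hXu
    have h2 := (norm_mul_le_left ((norm_mul_le_left n2' X).trans hXn) (D * V' - V' * D')).trans hu
    have h3 := ((norm_mul_le_right (D * V' - V' * D')ᴴ
      ((norm_mul_le_left hXn V').trans n2)).trans_eq
      (l2_opNorm_conjTranspose _)).trans hu
    have h4 := norm_add_le (V'ᴴ * (X * D - Dᴴ * X) * V' - V'ᴴ * X * (D * V' - V' * D'))
      ((D * V' - V' * D')ᴴ * (X * V'))
    have h5 := norm_sub_le (V'ᴴ * (X * D - Dᴴ * X) * V') (V'ᴴ * X * (D * V' - V' * D'))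
    linarith
  rw [mul_cutPoint_diagonal_sub, norm_smul] at hflip
  have hγn : ‖(γ * Complex.I : ℂ)‖ = γ := by simp [abs_of_pos hγ]
  rw [hγn, mul_comm, ← le_div_iff₀ hγ] at hflip
  obtain ⟨Y, hY, h1, h2⟩ := exists_anticommuting_near (κ := (τ + 2 * ρ) / γ / 2)
    (boolDiagonal_conjTranspose σ) (boolDiagonal_mul_self σ) (norm_boolDiagonal_le σ) hX₁n huni
    (by linarith) (by linarith)
  refine ⟨Y, hY, ?_, mul_cutPoint_diagonal_eq c γ h2⟩
  have e1 : X * V' - V' * Y = V * (Vᴴ * X * V') - V' * (Y - X₁) := by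
    rw [← hsplit, Matrix.mul_sub]; abel
  have e2 := (norm_mul_le_left n1 (Vᴴ * X * V')).trans off
  have e3 := (norm_mul_le_left n2 (Y - X₁)).trans h1
  have e4 := norm_sub_le (V * (Vᴴ * X * V')) (V' * (Y - X₁))
  have e5 := (norm_nonneg _).trans hflip
  rw [e1]
  linarith

end Split

section SplitRows

variable {ι Y Z : Type} [Fintype ι] [DecidableEq ι] [Fintype Y] [DecidableEq Y] [Fintype Z]
  [DecidableEq Z]

/-- The column of two square blocks, padded by zero rows. -/
def pairRows (Y Z : Type) (P Q : Matrix ι ι ℂ) : Matrix ((ι ⊕ Y) ⊕ (ι ⊕ Z)) ι ℂ :=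
  fromRows (fromRows P 0) (fromRows Q 0)

/-- The inclusion of the padding rows. -/
def padRows (ι Y Z : Type) [DecidableEq Y] [DecidableEq Z] :
    Matrix ((ι ⊕ Y) ⊕ (ι ⊕ Z)) (Y ⊕ Z) ℂ :=
  fromRows (fromRows 0 (fromCols 1 0)) (fromRows 0 (fromCols 0 1))

theorem pairRows_conjTranspose_mul (P Q P' Q' : Matrix ι ι ℂ) :
    (pairRows Y Z P Q)ᴴ * pairRows Y Z P' Q' = Pᴴ * P' + Qᴴ * Q' := by
  simp only [pairRows, conjTranspose_fromRows_eq_fromCols_conjTranspose, fromCols_mul_fromRows,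
    conjTranspose_zero, Matrix.zero_mul, add_zero]

theorem pairRows_conjTranspose_mul_padRows (P Q : Matrix ι ι ℂ) :
    (pairRows Y Z P Q)ᴴ * padRows ι Y Z = 0 := by
  simp [pairRows, padRows, conjTranspose_fromRows_eq_fromCols_conjTranspose, fromCols_mul_fromRows]

theorem padRows_conjTranspose_mul_pairRows (P Q : Matrix ι ι ℂ) :
    (padRows ι Y Z)ᴴ * pairRows Y Z P Q = 0 := by
  simp [pairRows, padRows, conjTranspose_fromRows_eq_fromCols_conjTranspose, fromCols_mul_fromRows]

theorem padRows_conjTranspose_mul : (padRows ι Y Z)ᴴ * padRows ι Y Z = 1 := by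
  simp only [padRows, conjTranspose_fromRows_eq_fromCols_conjTranspose, fromCols_mul_fromRows,
    conjTranspose_zero, zero_add, conjTranspose_fromCols_eq_fromRows_conjTranspose,
    conjTranspose_one, fromRows_mul_fromCols, Matrix.mul_zero, Matrix.mul_one]
  rw [fromBlocks_add]
  simp

theorem pairRows_mul (P Q R : Matrix ι ι ℂ) :
    (pairRows Y Z P Q * R : Matrix ((ι ⊕ Y) ⊕ (ι ⊕ Z)) ι ℂ) = pairRows Y Z (P * R) (Q * R) := by
  rw [pairRows, pairRows, fromRows_mul, fromRows_mul, fromRows_mul, Matrix.zero_mul,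
    Matrix.zero_mul]

theorem norm_pairRows_le (P Q : Matrix ι ι ℂ) : ‖pairRows Y Z P Q‖ ≤ ‖P‖ + ‖Q‖ := by
  have h1 : pairRows Y Z P Q =
      (pairRows Y Z (1 : Matrix ι ι ℂ) 0 * P : Matrix ((ι ⊕ Y) ⊕ (ι ⊕ Z)) ι ℂ) +
        (pairRows Y Z 0 (1 : Matrix ι ι ℂ) * Q : Matrix ((ι ⊕ Y) ⊕ (ι ⊕ Z)) ι ℂ) := by
    rw [pairRows_mul, pairRows_mul]
    ext ((i | i) | (i | i)) j <;> simp [pairRows]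
  have h2 : ‖pairRows Y Z (1 : Matrix ι ι ℂ) 0‖ ≤ 1 :=
    norm_le_one_of_isometry (by rw [pairRows_conjTranspose_mul]; simp)
  have h3 : ‖pairRows Y Z 0 (1 : Matrix ι ι ℂ)‖ ≤ 1 :=
    norm_le_one_of_isometry (by rw [pairRows_conjTranspose_mul]; simp)
  rw [h1]
  exact (norm_add_le _ _).trans (add_le_add (norm_mul_le_left h2 _) (norm_mul_le_left h3 _))

variable (Y Z) in
/-- A partition of unity `C² + S² = 1` embeds `ι` diagonally into two copies. -/
def splitOn (C S : ι → ℝ) : Matrix ((ι ⊕ Y) ⊕ (ι ⊕ Z)) ι ℂ :=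
  pairRows Y Z (diagonal fun i => (C i : ℂ)) (diagonal fun i => (S i : ℂ))

variable (Y Z) in
/-- The complement of `splitOn`. -/
def splitOff (C S : ι → ℝ) : Matrix ((ι ⊕ Y) ⊕ (ι ⊕ Z)) (ι ⊕ (Y ⊕ Z)) ℂ :=
  fromCols (pairRows Y Z (diagonal fun i => -(S i : ℂ)) (diagonal fun i => (C i : ℂ)))
    (padRows ι Y Z)

theorem split_isometry {C S : ι → ℝ} (h : ∀ i, C i ^ 2 + S i ^ 2 = 1) :
    (fromCols (splitOn Y Z C S) (splitOff Y Z C S))ᴴ *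
      fromCols (splitOn Y Z C S) (splitOff Y Z C S) = 1 := by
  have h' : ∀ i, (C i : ℂ) * C i + S i * S i = 1 := fun i => by
    have := h i
    exact_mod_cast (by linarith : C i * C i + S i * S i = 1)
  have e1 : (splitOn Y Z C S)ᴴ * splitOn Y Z C S = 1 := by
    rw [splitOn, pairRows_conjTranspose_mul]
    ext i j
    rcases eq_or_ne i j with rfl | hij
    · simp [diagonal_conjTranspose, h']
    · simp [diagonal_conjTranspose, hij]
  have e2 : (splitOn Y Z C S)ᴴ * splitOff Y Z C S = 0 := by
    rw [splitOn, splitOff, mul_fromCols, pairRows_conjTranspose_mul,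
      pairRows_conjTranspose_mul_padRows]
    ext i (j | j)
    · rcases eq_or_ne i j with rfl | hij
      · simp [diagonal_conjTranspose]; ring
      · simp [diagonal_conjTranspose, hij]
    · simp
  have e3 : (splitOff Y Z C S)ᴴ * splitOn Y Z C S = 0 := by
    rw [← conjTranspose_conjTranspose ((splitOff Y Z C S)ᴴ * splitOn Y Z C S), conjTranspose_mul,
      conjTranspose_conjTranspose, e2, conjTranspose_zero]
  have e4 : (splitOff Y Z C S)ᴴ * splitOff Y Z C S = 1 := by
    have e5 : (diagonal fun i => -(S i : ℂ))ᴴ * (diagonal fun i => -(S i : ℂ)) +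
        (diagonal fun i => (C i : ℂ))ᴴ * (diagonal fun i => (C i : ℂ)) = 1 := by
      ext i j
      rcases eq_or_ne i j with rfl | hij
      · have := h' i
        simp [diagonal_conjTranspose]; linear_combination this
      · simp [diagonal_conjTranspose, hij]
    rw [splitOff, conjTranspose_fromCols_eq_fromRows_conjTranspose, fromRows_mul_fromCols,
      pairRows_conjTranspose_mul, pairRows_conjTranspose_mul_padRows,
      padRows_conjTranspose_mul_pairRows, padRows_conjTranspose_mul, e5, fromBlocks_one]
  rw [conjTranspose_fromCols_eq_fromRows_conjTranspose, fromRows_mul_fromCols, e1, e2, e3, e4,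
    fromBlocks_one]

theorem split_coisometry {C S : ι → ℝ} (h : ∀ i, C i ^ 2 + S i ^ 2 = 1) :
    fromCols (splitOn Y Z C S) (splitOff Y Z C S) *
      (fromCols (splitOn Y Z C S) (splitOff Y Z C S))ᴴ = 1 := by
  rw [Matrix.mul_eq_one_comm_of_card_eq]
  · exact split_isometry h
  · simp only [Fintype.card_sum]; ring

theorem splitOn_intertwine {C S : ι → ℝ} {A : Matrix ι ι ℂ} {a : Matrix (ι ⊕ Y) (ι ⊕ Y) ℂ}
    {a' : Matrix (ι ⊕ Z) (ι ⊕ Z) ℂ}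
    (ha : a * (fromRows (diagonal fun i => (C i : ℂ)) 0 : Matrix (ι ⊕ Y) ι ℂ) =
      fromRows (A * diagonal fun i => (C i : ℂ)) 0)
    (ha' : a' * (fromRows (diagonal fun i => (S i : ℂ)) 0 : Matrix (ι ⊕ Z) ι ℂ) =
      fromRows (A * diagonal fun i => (S i : ℂ)) 0) :
    ‖fromBlocks a 0 0 a' * splitOn Y Z C S - splitOn Y Z C S * A‖ ≤
      ‖A * diagonal (fun i => (C i : ℂ)) - diagonal (fun i => (C i : ℂ)) * A‖ +
      ‖A * diagonal (fun i => (S i : ℂ)) - diagonal (fun i => (S i : ℂ)) * A‖ := by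
  refine le_of_eq_of_le (congrArg _ ?_) (norm_pairRows_le (Y := Y) (Z := Z) _ _)
  rw [splitOn, pairRows, fromBlocks_mul_fromRows, Matrix.zero_mul, Matrix.zero_mul, zero_add,
    add_zero, ha, ha', fromRows_mul, fromRows_mul, fromRows_mul, pairRows]
  ext ((i | i) | (i | i)) j <;> simp

theorem norm_diagonal_sub_mul_le {ρ : ℝ} (hρ : 0 ≤ ρ) {f g : ι → ℂ} {C : ι → ℝ}
    (hC : ∀ i, |C i| ≤ 1) (h : ∀ i, C i ≠ 0 → ‖f i - g i‖ ≤ ρ) :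
    ‖diagonal (fun i => (f i - g i) * (C i : ℂ))‖ ≤ ρ := by
  refine norm_diagonal_le hρ fun i => ?_
  by_cases hi : C i = 0
  · simpa [hi] using hρ
  · rw [norm_mul, Complex.norm_real, Real.norm_eq_abs]
    nlinarith [h i hi, hC i, norm_nonneg (f i - g i), abs_nonneg (C i)]

theorem splitOn_diagonal {ρ : ℝ} (hρ : 0 ≤ ρ) {C S : ι → ℝ} {f g v : ι → ℂ} (y : Y → ℂ) (z : Z → ℂ)
    (hC : ∀ i, |C i| ≤ 1) (hS : ∀ i, |S i| ≤ 1)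
    (hf : ∀ i, C i ≠ 0 → ‖f i - v i‖ ≤ ρ) (hg : ∀ i, S i ≠ 0 → ‖g i - v i‖ ≤ ρ) :
    ‖diagonal (Sum.elim (Sum.elim f y) (Sum.elim g z)) * splitOn Y Z C S -
      splitOn Y Z C S * diagonal v‖ ≤ 2 * ρ := by
  have h1 := norm_pairRows_le (Y := Y) (Z := Z) (diagonal (fun i => (f i - v i) * (C i : ℂ)))
    (diagonal (fun i => (g i - v i) * (S i : ℂ)))
  have h2 := norm_diagonal_sub_mul_le hρ hC hf
  have h3 := norm_diagonal_sub_mul_le hρ hS hg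
  refine le_of_eq_of_le (congrArg _ ?_) (h1.trans (by linarith))
  ext ((i | i) | (i | i)) j <;>
    simp only [Matrix.sub_apply, diagonal_mul, mul_diagonal, splitOn, pairRows, fromRows_apply_inl,
      fromRows_apply_inr, Sum.elim_inl, Sum.elim_inr, Matrix.zero_apply, mul_zero, zero_mul,
      sub_zero] <;>
    (rcases eq_or_ne i j with rfl | hij
     · simp; ring
     · simp [hij])

theorem splitOff_diagonal {ρ : ℝ} (hρ : 0 ≤ ρ) {C S : ι → ℝ} {f g v : ι → ℂ} (y : Y → ℂ)
    (z : Z → ℂ) (hC : ∀ i, |C i| ≤ 1) (hS : ∀ i, |S i| ≤ 1)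
    (hf : ∀ i, S i ≠ 0 → ‖f i - v i‖ ≤ ρ) (hg : ∀ i, C i ≠ 0 → ‖g i - v i‖ ≤ ρ) :
    ‖diagonal (Sum.elim (Sum.elim f y) (Sum.elim g z)) * splitOff Y Z C S -
      splitOff Y Z C S * diagonal (Sum.elim v (Sum.elim y z))‖ ≤ 2 * ρ := by
  have h1 := norm_pairRows_le (Y := Y) (Z := Z) (-diagonal (fun i => (f i - v i) * (S i : ℂ)))
    (diagonal (fun i => (g i - v i) * (C i : ℂ)))
  have h2 := norm_diagonal_sub_mul_le hρ hC hg
  have h3 := norm_diagonal_sub_mul_le hρ hS hf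
  have h4 := norm_fromCols_le (pairRows Y Z (-diagonal (fun i => (f i - v i) * (S i : ℂ)))
    (diagonal (fun i => (g i - v i) * (C i : ℂ)))) (0 : Matrix ((ι ⊕ Y) ⊕ (ι ⊕ Z)) (Y ⊕ Z) ℂ)
  rw [norm_neg] at h1
  rw [norm_zero] at h4
  refine le_of_eq_of_le (congrArg _ ?_) (h4.trans (by linarith))
  ext ((i | i) | (i | i)) (j | (j | j)) <;>
    simp only [Matrix.sub_apply, diagonal_mul, mul_diagonal, splitOff, pairRows, padRows,
      fromRows_apply_inl, fromRows_apply_inr, fromCols_apply_inl, fromCols_apply_inr, Sum.elim_inl,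
      Sum.elim_inr, Matrix.zero_apply, mul_zero, zero_mul, sub_zero, Matrix.neg_apply] <;>
    (try rcases eq_or_ne i j with rfl | hij
     · simp; try ring
     · simp [hij])

end SplitRows

section Glue

theorem abs_im_sub_sq_le {z w : ℂ} (hz : ‖z‖ = 1) (hw : ‖w‖ = 1) :
    (|z.im| - |w.im|) ^ 2 ≤ 2 * |z.re - w.re| := by
  have h1 := im_sq_of_norm_eq_one hz
  have h2 := im_sq_of_norm_eq_one hw
  have h3 : |z.re + w.re| ≤ 2 := by
    have e1 := (Complex.abs_re_le_norm z).trans_eq hz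
    have e2 := (Complex.abs_re_le_norm w).trans_eq hw
    exact (abs_add_le _ _).trans (by linarith)
  have h4 : |z.im ^ 2 - w.im ^ 2| ≤ 2 * |z.re - w.re| := by
    rw [h1, h2, show 1 - z.re ^ 2 - (1 - w.re ^ 2) = -((z.re + w.re) * (z.re - w.re)) by ring,
      abs_neg, abs_mul]
    exact mul_le_mul_of_nonneg_right h3 (abs_nonneg _)
  refine le_trans ?_ h4
  rw [show z.im ^ 2 - w.im ^ 2 = (|z.im| - |w.im|) * (|z.im| + |w.im|) by
    rw [← sq_abs z.im, ← sq_abs w.im]; ring, abs_mul,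
    abs_of_nonneg (add_nonneg (abs_nonneg z.im) (abs_nonneg w.im)), ← sq_abs, sq]
  refine mul_le_mul_of_nonneg_left ?_ (abs_nonneg _)
  rw [abs_le]
  constructor <;> linarith [abs_nonneg z.im, abs_nonneg w.im]

/-- Unit complex numbers on the same side of the real axis are determined by their real parts,
uniformly continuously. -/
theorem exists_near_of_re_near {ω : ℝ} (hω : 0 < ω) :
    ∃ η > 0, ∀ (z w : ℂ) (b : Bool), ‖z‖ = 1 → ‖w‖ = 1 → (z.im : ℂ) = |z.im| * boolSign b →
      (w.im : ℂ) = |w.im| * boolSign b → |z.re - w.re| < η → ‖z - w‖ < ω := by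
  refine ⟨min 1 (ω ^ 2 / 4), by positivity, fun z w b hz hw hzb hwb h => ?_⟩
  have h1 := abs_im_sub_sq_le hz hw
  have h2 : (z.im - w.im) ^ 2 = (|z.im| - |w.im|) ^ 2 := by
    have h3 : ((z.im - w.im : ℝ) : ℂ) = (|z.im| - |w.im| : ℝ) * boolSign b := by
      push_cast; rw [hzb, hwb]; ring
    have h4 := congrArg norm h3
    rw [norm_mul, norm_boolSign, mul_one, Complex.norm_real, Complex.norm_real] at h4
    rw [← sq_abs (z.im - w.im), ← sq_abs (|z.im| - |w.im|)]
    exact congrArg (· ^ 2) h4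
  have h5 : |z.re - w.re| ^ 2 ≤ |z.re - w.re| := by
    have := h.trans_le (min_le_left _ _)
    nlinarith [abs_nonneg (z.re - w.re)]
  have h6 : ‖z - w‖ ^ 2 < ω ^ 2 := by
    rw [← Complex.normSq_eq_norm_sq, Complex.normSq_apply, Complex.sub_re, Complex.sub_im]
    have := h.trans_le (min_le_right _ _)
    rw [sq_abs] at h5
    have := sq_nonneg ω
    nlinarith
  exact lt_of_pow_lt_pow_left₀ 2 hω.le h6

theorem im_eq_abs_mul_boolSign (z : ℂ) : (z.im : ℂ) = |z.im| * boolSign (decide (0 ≤ z.im)) := by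
  rcases le_or_gt 0 z.im with h | h
  · simp [h, boolSign, abs_of_nonneg h]
  · simp [not_le.2 h, boolSign, abs_of_neg h]

theorem cutPoint_im_eq {γ : ℝ} (hγ : 0 ≤ γ) (c : ℝ) (b : Bool) :
    ((cutPoint c γ b).im : ℂ) = |(cutPoint c γ b).im| * boolSign b := by
  cases b <;> simp [cutPoint, boolSign, abs_of_nonneg hγ]

/-- Every unit complex number has a root, which can be taken close to a given approximate one. -/
theorem exists_root_of_norm_eq_one {n : ℕ} (hn : n ≠ 0) {t : ℂ} (ht : ‖t‖ = 1) :
    ∃ b : ℂ, ‖b‖ = 1 ∧ b ^ n = t := by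
  obtain ⟨b, hb⟩ := IsAlgClosed.exists_pow_nat_eq t (Nat.pos_of_ne_zero hn)
  refine ⟨b, ?_, hb⟩
  have : ‖b‖ ^ n = 1 := by rw [← norm_pow, hb, ht]
  exact (pow_eq_one_iff_of_nonneg (norm_nonneg _) hn).1 this

theorem truncRight_re (c γ : ℝ) (z : ℂ) (b : Bool) : (truncRight c γ z b).re = max z.re c := by
  rw [truncRight]; split_ifs with h
  · rw [max_eq_left h]
  · rw [cutPoint_re, max_eq_right (not_le.1 h).le]

/-- Stability over two adjacent intervals gives stability over their union. -/
theorem Stab.glue {n : ℕ} (hn : n ≠ 0) {c d ε ε' : ℝ} (hc : -1 < c) (hc1 : c < 1) (hcd : c ≤ d)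
    (h1 : Stab n ε (Set.Iic c)) (h2 : Stab n ε (Set.Icc c d)) (hε : ε < ε') :
    Stab n ε' (Set.Iic d) := by
  obtain ⟨δ₁, hδ₁, H₁⟩ := h1
  obtain ⟨δ₂, hδ₂, H₂⟩ := h2
  set q := min (ε' - ε) 1 / 8 with hq
  have hεε : 0 < ε' - ε := by linarith
  have hq0 : 0 < q := by positivity
  have hq1 : 8 * q ≤ ε' - ε := by rw [hq]; linarith [min_le_left (ε' - ε) 1]
  have hq2 : 8 * q ≤ 1 := by rw [hq]; linarith [min_le_right (ε' - ε) 1]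
  set γ := √(1 - c ^ 2) with hγdef
  have hcsq : 0 < 1 - c ^ 2 := one_sub_sq_pos_of_mem hc hc1 le_rfl le_rfl
  have hγ : 0 < γ := Real.sqrt_pos.2 hcsq
  have hcγ : c ^ 2 + γ ^ 2 = 1 := by rw [hγdef, Real.sq_sqrt hcsq.le]; ring
  set τ := q * γ / 3 with hτ
  have hτ0 : 0 < τ := by positivity
  obtain ⟨ω', hω', Hroot⟩ := exists_root_near hn (half_pos hq0)
  obtain ⟨η₀, hη₀, Hnear⟩ := exists_near_of_re_near (lt_min hω' (half_pos hτ0))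
  set η := min η₀ (min ((1 - c) / 3) ((1 + c) / 3)) with hη
  have hη0 : 0 < η := lt_min hη₀ (lt_min (by linarith) (by linarith))
  have hη1 : c + 2 * η < 1 := by
    have : η ≤ (1 - c) / 3 := (min_le_right _ _).trans (min_le_left _ _)
    linarith
  have hη2 : -1 < c - 2 * η := by
    have : η ≤ (1 + c) / 3 := (min_le_right _ _).trans (min_le_right _ _)
    linarith
  obtain ⟨δ₃, hδ₃, HL⟩ := exists_truncLeft_flip (k := c + η) (d := c + 2 * η) hγ hcγ (by linarith)
    (by linarith) hη1 (lt_min hδ₁ hτ0)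
  obtain ⟨δ₄, hδ₄, HR⟩ := exists_truncRight_flip (k := c - η) (d := c - 2 * η) hγ hcγ (by linarith)
    (by linarith) hη2 (lt_min hδ₂ hτ0)
  set Cf : ℝ → ℝ := fun x => Real.sin (Real.pi / 2 * cutoff (c - η) (c + η) x) with hCf
  set Sf : ℝ → ℝ := fun x => Real.cos (Real.pi / 2 * cutoff (c - η) (c + η) x) with hSf
  have hcut := continuous_cutoff (c - η) (c + η)
  have hCfz : ∀ x, c + η ≤ x → Cf x = 0 := fun x hx => by
    simp only [hCf, cutoff_of_ge (by linarith : c - η < c + η) hx, mul_zero, Real.sin_zero]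
  have hSfz : ∀ x, x ≤ c - η → Sf x = 0 := fun x hx => by
    simp only [hSf, cutoff_of_le (by linarith : c - η < c + η) hx, mul_one, Real.cos_pi_div_two]
  obtain ⟨δ₅, hδ₅, HC⟩ := exists_delta_flip (F := fun z => (Cf z.re : ℂ)) (by fun_prop)
    (half_pos hq0)
  obtain ⟨δ₆, hδ₆, HS⟩ := exists_delta_flip (F := fun z => (Sf z.re : ℂ)) (by fun_prop)
    (half_pos hq0)
  have Hζ : ∀ b : Bool, ∃ z : ℂ, ‖z‖ = 1 ∧ z ^ n = cutPoint c γ b := fun b =>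
    exists_root_of_norm_eq_one hn (norm_cutPoint hcγ b)
  choose ζ hζ1 hζ2 using Hζ
  refine ⟨min δ₃ (min δ₄ (min δ₅ δ₆)), by positivity, fun ι _ _ β A hA hβ hβI hflip => ?_⟩
  have hA1 := norm_unitary_le hA
  set u : ι → ℂ := fun i => β i ^ n with hu
  have hu1 : ∀ i, ‖u i‖ = 1 := fun i => by rw [hu]; simp [hβ i]
  set s : ι → Bool := fun i => decide (0 ≤ (u i).im) with hs
  have hsu : ∀ i, ((u i).im : ℂ) = |(u i).im| * boolSign (s i) := fun i =>
    im_eq_abs_mul_boolSign (u i)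
  obtain ⟨Y, _, _, t, a, ha, haf, hac⟩ := HL ι A u s hA hu1 hsu (hflip.trans (min_le_left _ _))
  obtain ⟨Z, _, _, t', a', ha', haf', hac'⟩ := HR ι A u s hA hu1 hsu
    (hflip.trans ((min_le_right _ _).trans (min_le_left _ _)))
  have eC := HC ι A u hA1 hu1
    (hflip.trans ((min_le_right _ _).trans ((min_le_right _ _).trans (min_le_left _ _))))
  have eS := HS ι A u hA1 hu1
    (hflip.trans ((min_le_right _ _).trans ((min_le_right _ _).trans (min_le_right _ _))))
  simp only [Complex.star_def, Complex.conj_re] at eC eS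
  set C : ι → ℝ := fun i => Cf (u i).re with hC
  set S : ι → ℝ := fun i => Sf (u i).re with hS
  have hCS : ∀ i, C i ^ 2 + S i ^ 2 = 1 := fun i => Real.sin_sq_add_cos_sq _
  have hC1 : ∀ i, |C i| ≤ 1 := fun i => Real.abs_sin_le_one _
  have hS1 : ∀ i, |S i| ≤ 1 := fun i => Real.abs_cos_le_one _
  have hCne : ∀ i, C i ≠ 0 → (u i).re < c + η := fun i hi => by
    by_contra h; exact hi (hCfz _ (not_lt.1 h))
  have hSne : ∀ i, S i ≠ 0 → c - η < (u i).re := fun i hi => by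
    by_contra h; exact hi (hSfz _ (not_lt.1 h))
  have hXV := splitOn_intertwine (C := C) (S := S)
    (hac _ fun i hi => by rw [hC]; simp only [hCfz _ hi.le, Complex.ofReal_zero])
    (hac' _ fun i hi => by rw [hS]; simp only [hSfz _ hi.le, Complex.ofReal_zero])
  have Hg : ∀ i, ∃ g : ℂ, ‖g‖ = 1 ∧ g ^ n = cutPoint c γ (s i) ∧
      (|c - (u i).re| < η → ‖g - β i‖ ≤ q / 2 ∧ ‖cutPoint c γ (s i) - u i‖ ≤ τ / 2) := by
    intro i
    by_cases hi : |c - (u i).re| < η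
    · have := Hnear (cutPoint c γ (s i)) (u i) (s i) (norm_cutPoint hcγ _) (hu1 i)
        (cutPoint_im_eq hγ.le _ _) (hsu i) (by
          rw [cutPoint_re]; exact hi.trans_le (min_le_left _ _))
      obtain ⟨g, h1, h2, h3⟩ := Hroot _ (β i) (norm_cutPoint hcγ (s i)) (hβ i)
        (this.trans_le (min_le_left _ _))
      exact ⟨g, h1, h2, fun _ => ⟨h3.le, this.le.trans (min_le_right _ _)⟩⟩
    · exact ⟨ζ (s i), hζ1 _, hζ2 _, fun h => absurd h hi⟩
  choose g hg1 hg2 hg3 using Hg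
  set βL : ι → ℂ := fun i => if (u i).re ≤ c then β i else g i with hβL
  set βR : ι → ℂ := fun i => if c ≤ (u i).re then β i else g i with hβR
  have hβLn : (fun i => Sum.elim βL (fun z => ζ (t z)) i ^ n) =
      Sum.elim (fun i => truncLeft c γ (u i) (s i)) fun z => cutPoint c γ (t z) := by
    ext (i | z)
    · simp only [Sum.elim_inl, hβL, truncLeft]; split_ifs; exacts [rfl, hg2 i]
    · simp only [Sum.elim_inr, hζ2]
  have hβRn : (fun i => Sum.elim βR (fun z => ζ (t' z)) i ^ n) =
      Sum.elim (fun i => truncRight c γ (u i) (s i)) fun z => cutPoint c γ (t' z) := by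
    ext (i | z)
    · simp only [Sum.elim_inl, hβR, truncRight]; split_ifs; exacts [rfl, hg2 i]
    · simp only [Sum.elim_inr, hζ2]
  have hNL : NearRep n ε a (diagonal (Sum.elim βL fun z => ζ (t z))) := by
    refine H₁ _ _ a ha ?_ ?_ ?_
    · rintro (i | z)
      · simp only [Sum.elim_inl, hβL]; split_ifs; exacts [hβ i, hg1 i]
      · simp only [Sum.elim_inr, hζ1]
    · intro i
      rw [congrFun hβLn i]
      rcases i with i | z
      · simp only [Sum.elim_inl, truncLeft_re, Set.mem_Iic]; exact min_le_right _ _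
      · simp only [Sum.elim_inr, cutPoint_re, Set.mem_Iic, le_refl]
    · have : (fun i => star (Sum.elim βL (fun z => ζ (t z)) i ^ n)) = fun i =>
          star (Sum.elim (fun i => truncLeft c γ (u i) (s i)) (fun z => cutPoint c γ (t z)) i) := by
        ext i; rw [congrFun hβLn i]
      rw [this, hβLn]
      exact haf.trans (min_le_left _ _)
  have hNR : NearRep n ε a' (diagonal (Sum.elim βR fun z => ζ (t' z))) := by
    refine H₂ _ _ a' ha' ?_ ?_ ?_
    · rintro (i | z)
      · simp only [Sum.elim_inl, hβR]; split_ifs; exacts [hβ i, hg1 i]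
      · simp only [Sum.elim_inr, hζ1]
    · intro i
      rw [congrFun hβRn i]
      rcases i with i | z
      · simp only [Sum.elim_inl, truncRight_re, Set.mem_Icc]
        exact ⟨le_max_right _ _, max_le (hβI i) hcd⟩
      · simp only [Sum.elim_inr, cutPoint_re, Set.mem_Icc]
        exact ⟨le_rfl, hcd⟩
    · have : (fun i => star (Sum.elim βR (fun z => ζ (t' z)) i ^ n)) = fun i =>
          star (Sum.elim (fun i => truncRight c γ (u i) (s i))
            (fun z => cutPoint c γ (t' z)) i) := by
        ext i; rw [congrFun hβRn i]
      rw [this, hβRn]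
      exact haf'.trans (min_le_left _ _)
  have hW := split_isometry (Y := Y) (Z := Z) hCS
  have hW' := split_coisometry (Y := Y) (Z := Z) hCS
  have hXVq := hXV.trans (add_le_add eC eS)
  rw [add_halves] at hXVq
  set σ : ι ⊕ (Y ⊕ Z) → Bool := Sum.elim s (Sum.elim t t') with hσ
  set βG : ι ⊕ (Y ⊕ Z) → ℂ := Sum.elim g (Sum.elim (fun z => ζ (t z)) fun z => ζ (t' z)) with hβG
  have hnear1 : ∀ i, (u i).re ≤ c → S i ≠ 0 → |c - (u i).re| < η := fun i h1 h2 => by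
    have := hSne i h2
    rw [abs_lt]; constructor <;> linarith
  have hnear2 : ∀ i, c ≤ (u i).re → C i ≠ 0 → |c - (u i).re| < η := fun i h1 h2 => by
    have := hCne i h2
    rw [abs_lt]; constructor <;> linarith
  have hu_flip : ‖fromBlocks a 0 0 a' * diagonal (Sum.elim
        (Sum.elim (fun i => truncLeft c γ (u i) (s i)) fun z => cutPoint c γ (t z))
        (Sum.elim (fun i => truncRight c γ (u i) (s i)) fun z => cutPoint c γ (t' z))) -
      diagonal (fun i => star (Sum.elim
        (Sum.elim (fun i => truncLeft c γ (u i) (s i)) fun z => cutPoint c γ (t z))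
        (Sum.elim (fun i => truncRight c γ (u i) (s i)) fun z => cutPoint c γ (t' z)) i)) *
        fromBlocks a 0 0 a'‖ ≤ τ := by
    refine le_of_eq_of_le (congrArg _ ?_) (norm_fromBlocks_diag_le
      (haf.trans (min_le_right _ _)) (haf'.trans (min_le_right _ _)))
    rw [← fromBlocks_diag_sub]
    congr 1
    · rw [← fromBlocks_diagonal, fromBlocks_multiply]; simp
    · have : ∀ (P Q : Type) (f : P → ℂ) (h : Q → ℂ), (fun i => star (Sum.elim f h i)) =
          Sum.elim (fun i => star (f i)) fun i => star (h i) := by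
        intro P Q f h; ext (i | i) <;> rfl
      rw [this, ← fromBlocks_diagonal, fromBlocks_multiply]; simp
  have hu_off := splitOff_diagonal (Y := Y) (Z := Z) (C := C) (S := S) (half_pos hτ0).le
    (f := fun i => truncLeft c γ (u i) (s i)) (g := fun i => truncRight c γ (u i) (s i))
    (v := fun i => cutPoint c γ (s i)) (fun z => cutPoint c γ (t z)) (fun z => cutPoint c γ (t' z))
    hC1 hS1
    (fun i hi => by
      simp only [truncLeft]
      split_ifs with h
      · rw [norm_sub_rev]; exact (hg3 i (hnear1 i h hi)).2
      · rw [sub_self, norm_zero]; positivity)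
    (fun i hi => by
      simp only [truncRight]
      split_ifs with h
      · rw [norm_sub_rev]; exact (hg3 i (hnear2 i h hi)).2
      · rw [sub_self, norm_zero]; positivity)
  rw [mul_div_cancel₀ _ two_ne_zero] at hu_off
  have hσe : (Sum.elim (fun i => cutPoint c γ (s i))
      (Sum.elim (fun z => cutPoint c γ (t z)) fun z => cutPoint c γ (t' z))) =
      fun i => cutPoint c γ (σ i) := by
    ext (i | (i | i)) <;> rfl
  rw [hσe] at hu_off
  have hsum : (τ + 2 * τ) / γ = q := by rw [hτ]; field_simp; ring
  obtain ⟨AG, hAG, hXVG, hAGe⟩ := exists_complement hγ hW hW' (fromBlocks_mem_unitary ha ha') hA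
    (by linarith) hXVq hu_flip hu_off (by rw [hsum]; linarith)
  rw [hsum] at hXVG
  have hGn : ∀ i, βG i ^ n = cutPoint c γ (σ i) := by
    rintro (i | (z | z))
    exacts [hg2 i, hζ2 _, hζ2 _]
  have hGexact : IsExactPair n AG (diagonal βG) := by
    refine isExactPair_diagonal hAG ?_ ?_
    · rintro (i | (z | z))
      exacts [hg1 i, hζ1 _, hζ1 _]
    · simp only [hGn]; exact hAGe
  have hBon := splitOn_diagonal (Y := Y) (Z := Z) (C := C) (S := S) (half_pos hq0).le
    (f := βL) (g := βR) (v := β) (fun z => ζ (t z)) (fun z => ζ (t' z)) hC1 hS1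
    (fun i hi => by
      simp only [hβL]
      split_ifs with h
      · rw [sub_self, norm_zero]; positivity
      · exact (hg3 i (hnear2 i (not_le.1 h).le hi)).1)
    (fun i hi => by
      simp only [hβR]
      split_ifs with h
      · rw [sub_self, norm_zero]; positivity
      · exact (hg3 i (hnear1 i (not_le.1 h).le hi)).1)
  have hBoff := splitOff_diagonal (Y := Y) (Z := Z) (C := C) (S := S) (half_pos hq0).le
    (f := βL) (g := βR) (v := g) (fun z => ζ (t z)) (fun z => ζ (t' z)) hC1 hS1
    (fun i hi => by
      simp only [hβL]
      split_ifs with h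
      · rw [norm_sub_rev]; exact (hg3 i (hnear1 i h hi)).1
      · rw [sub_self, norm_zero]; positivity)
    (fun i hi => by
      simp only [hβR]
      split_ifs with h
      · rw [norm_sub_rev]; exact (hg3 i (hnear2 i h hi)).1
      · rw [sub_self, norm_zero]; positivity)
  have hNM := (hNL.sum hNR).conj hW' hW
  rw [fromBlocks_diagonal] at hNM
  have hfin := hNM.perturb (ω := ε' - ε) hεε.le
    (A' := fromBlocks A 0 0 AG) (B' := fromBlocks (diagonal β) 0 0 (diagonal βG))
    (by
      rw [norm_sub_rev]
      exact (norm_conj_sub_fromBlocks_le hW _ _ _).trans (by linarith))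
    (by
      rw [norm_sub_rev]
      exact (norm_conj_sub_fromBlocks_le hW _ _ _).trans (by linarith))
  rw [add_sub_cancel] at hfin
  exact hfin.cancel hGexact

end Glue

section Stability

theorem nearRep_of_near {n : ℕ} {ε ω' : ℝ} (hε : 0 < ε)
    (hroot : ∀ t b : ℂ, ‖t‖ = 1 → ‖b‖ = 1 → ‖t - b ^ n‖ < ω' →
      ∃ b' : ℂ, ‖b'‖ = 1 ∧ b' ^ n = t ∧ ‖b' - b‖ < ε)
    {ι : Type} [Fintype ι] [DecidableEq ι] {A Y : Matrix ι ι ℂ} {β t : ι → ℂ}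
    (hY : Y ∈ unitary (Matrix ι ι ℂ)) (hAY : ‖A - Y‖ ≤ ε) (hβ : ∀ i, ‖β i‖ = 1)
    (ht : ∀ i, ‖t i‖ = 1) (hβt : ∀ i, ‖t i - β i ^ n‖ < ω')
    (hYt : Y * diagonal t = diagonal (fun i => star (t i)) * Y) : NearRep n ε A (diagonal β) := by
  choose g hg1 hg2 hg3 using fun i => hroot (t i) (β i) (ht i) (hβ i) (hβt i)
  refine (isExactPair_diagonal hY hg1 ?_).nearRep hε.le hAY ?_
  · simp only [hg2]; exact hYt
  · rw [diagonal_sub]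
    exact norm_diagonal_le hε.le fun i => by rw [norm_sub_rev]; exact (hg3 i).le

/-- Clamping the rescaled imaginary part recovers its sign away from the real axis. -/
theorem clamp_im_eq {γ : ℝ} (hγ : 0 < γ) {z : ℂ} {b : Bool}
    (hb : (z.im : ℂ) = |z.im| * boolSign b) (hz : γ ≤ |z.im|) :
    ((max (-1) (min 1 (z.im / γ)) : ℝ) : ℂ) = boolSign b := by
  cases b
  · have h1 : z.im = -|z.im| := by
      have : (z.im : ℂ) = ((-|z.im| : ℝ) : ℂ) := by rw [hb]; simp [boolSign]
      exact_mod_cast this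
    have h2 : z.im / γ ≤ -1 := by rw [div_le_iff₀ hγ]; linarith
    rw [min_eq_right (by linarith), max_eq_left h2]
    simp [boolSign]
  · have h1 : z.im = |z.im| := by
      have : (z.im : ℂ) = ((|z.im| : ℝ) : ℂ) := by rw [hb]; simp [boolSign]
      exact_mod_cast this
    have h2 : 1 ≤ z.im / γ := by rw [le_div_iff₀ hγ]; linarith
    rw [min_eq_left h2, max_eq_right (by norm_num)]
    simp [boolSign]

theorem clamp_star_im (γ : ℝ) (z : ℂ) :
    max (-1) (min 1 ((star z).im / γ)) = -max (-1) (min 1 (z.im / γ)) := by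
  rw [Complex.star_def, Complex.conj_im, neg_div, ← min_neg_neg, neg_neg, ← max_neg_neg]
  rcases le_total 1 (z.im / γ) with h | h <;> rcases le_total (-1) (z.im / γ) with h' | h' <;>
    simp [max_def, min_def] <;> split_ifs <;> linarith

/-- Stability over intervals which are short enough. -/
theorem exists_stab_short {n : ℕ} (hn : n ≠ 0) {ε : ℝ} (hε : 0 < ε) :
    ∃ h > 0, ∀ c d : ℝ, d - c ≤ h → Stab n ε (Set.Icc c d) := by
  obtain ⟨ω', hω', Hroot⟩ := exists_root_near hn hε
  obtain ⟨η₀, hη₀, Hnear⟩ := exists_near_of_re_near hω'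
  set η := min η₀ 1 with hη
  have hη0 : 0 < η := lt_min hη₀ one_pos
  have hη1 : η ≤ 1 := min_le_right _ _
  have hηη : η ≤ η₀ := min_le_left _ _
  have real_case : ∀ (c d e : ℝ), e ^ 2 = 1 → (∀ x, x ∈ Set.Icc c d → |x| ≤ 1 → |e - x| < η) →
      Stab n ε (Set.Icc c d) := by
    intro c d e he hx
    refine ⟨1, one_pos, fun ι _ _ β A hA hβ hβI _ => ?_⟩
    have hu1 : ∀ i, ‖β i ^ n‖ = 1 := fun i => by simp [hβ i]
    have he1 : ‖(e : ℂ)‖ = 1 := by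
      rw [Complex.norm_real, Real.norm_eq_abs]
      exact (pow_eq_one_iff_of_nonneg (abs_nonneg e) two_ne_zero).1 (by rw [sq_abs, he])
    refine nearRep_of_near hε Hroot (t := fun _ => (e : ℂ)) hA (by simpa using hε.le) hβ
      (fun _ => he1) (fun i => ?_) ?_
    · refine Hnear _ _ (decide (0 ≤ (β i ^ n).im)) he1 (hu1 i) (by simp) (im_eq_abs_mul_boolSign _)
        ((hx _ (hβI i) ((Complex.abs_re_le_norm _).trans_eq (hu1 i))).trans_le hηη)
    · ext i j
      simp [mul_comm]
  refine ⟨η / 2, by positivity, fun c d hcd => ?_⟩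
  rcases lt_or_ge (1 - η / 2) d with hd | hd
  · refine real_case c d 1 (by norm_num) fun x hx hx1 => ?_
    have := abs_le.1 hx1
    rw [abs_lt]; constructor <;> linarith [hx.1]
  rcases lt_or_ge c (-1 + η / 2) with hc | hc
  · refine real_case c d (-1) (by norm_num) fun x hx hx1 => ?_
    have := abs_le.1 hx1
    rw [abs_lt]; constructor <;> linarith [hx.2]
  rcases lt_or_ge d c with hdc | hdc
  · exact real_case c d 1 (by norm_num) fun x hx => absurd (hx.1.trans hx.2) (not_le.2 hdc)
  set γ₀ := √(η / 2) with hγ₀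
  have hγ₀0 : 0 < γ₀ := Real.sqrt_pos.2 (by linarith)
  have hcsq : 0 < 1 - c ^ 2 := by nlinarith
  set γ := √(1 - c ^ 2) with hγ
  have hγ0 : 0 < γ := Real.sqrt_pos.2 hcsq
  have hcγ : c ^ 2 + γ ^ 2 = 1 := by rw [hγ, Real.sq_sqrt hcsq.le]; ring
  set κ := min (ε / 3) (1 / 4) with hκ
  have hκ0 : 0 < κ := by positivity
  obtain ⟨δ, hδ, H⟩ := exists_delta_flip
    (F := fun z => ((max (-1) (min 1 (z.im / γ₀)) : ℝ) : ℂ)) (by fun_prop) (ε := 2 * κ)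
    (by positivity)
  refine ⟨δ, hδ, fun ι _ _ β A hA hβ hβI hflip => ?_⟩
  have hA1 := norm_unitary_le hA
  set u : ι → ℂ := fun i => β i ^ n with hu
  have hu1 : ∀ i, ‖u i‖ = 1 := fun i => by rw [hu]; simp [hβ i]
  set s : ι → Bool := fun i => decide (0 ≤ (u i).im) with hs
  have hsu : ∀ i, ((u i).im : ℂ) = |(u i).im| * boolSign (s i) := fun i =>
    im_eq_abs_mul_boolSign (u i)
  have him : ∀ i, γ₀ ≤ |(u i).im| := fun i => by
    rw [hγ₀]
    refine Real.sqrt_le_iff.2 ⟨abs_nonneg _, ?_⟩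
    rw [sq_abs, im_sq_of_norm_eq_one (hu1 i)]
    have h1 := (hβI i).1
    have h2 := (hβI i).2
    have h3 : (u i).re = (β i ^ n).re := rfl
    nlinarith
  have e := H ι A u hA1 hu1 hflip
  simp only [clamp_star_im, Complex.ofReal_neg, clamp_im_eq hγ₀0 (hsu _) (him _)] at e
  have e' : ‖A * diagonal (fun i => boolSign (s i)) + diagonal (fun i => boolSign (s i)) * A‖ ≤
      2 * κ := by
    refine le_of_eq_of_le (congrArg _ ?_) e
    ext i j
    simp
  obtain ⟨Y, hY, hYA, hYs⟩ := exists_anticommuting_near (η := 0) (boolDiagonal_conjTranspose s)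
    (boolDiagonal_mul_self s) (norm_boolDiagonal_le s) hA1
    (by rw [show Aᴴ * A = 1 from Unitary.star_mul_self_of_mem hA]; simp) e'
    (by linarith [min_le_right (ε / 3) (1 / 4)])
  refine nearRep_of_near hε Hroot (t := fun i => cutPoint c γ (s i)) hY ?_ hβ
    (fun i => norm_cutPoint hcγ _) (fun i => ?_) (mul_cutPoint_diagonal_eq c γ hYs)
  · rw [norm_sub_rev]
    linarith [min_le_left (ε / 3) (1 / 4)]
  · refine Hnear _ _ (s i) (norm_cutPoint hcγ _) (hu1 i) (cutPoint_im_eq hγ0.le _ _) (hsu i) ?_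
    rw [cutPoint_re]
    have h1 := (hβI i).1
    have h2 := (hβI i).2
    rw [abs_lt]; constructor <;> linarith

theorem Stab.of_subset {n : ℕ} {ε ε' : ℝ} {I J : Set ℝ} (h : Stab n ε I) (hε : ε ≤ ε')
    (hIJ : ∀ x ∈ J, |x| ≤ 1 → x ∈ I) : Stab n ε' J := by
  obtain ⟨δ, hδ, H⟩ := h
  refine ⟨δ, hδ, fun ι _ _ β A hA hβ hβI hflip => (H ι β A hA hβ (fun i => ?_) hflip).mono hε⟩
  exact hIJ _ (hβI i) ((Complex.abs_re_le_norm _).trans_eq (by simp [hβ i]))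

theorem stab_univ {n : ℕ} (hn : n ≠ 0) {ε : ℝ} (hε : 0 < ε) : Stab n ε Set.univ := by
  obtain ⟨h, hh, H⟩ := exists_stab_short hn (half_pos hε)
  have key : ∀ k : ℕ, ∀ ε' > ε / 2, Stab n ε' (Set.Iic (-1 + (k + 1) * h)) := by
    intro k
    induction k with
    | zero =>
      intro ε' hε'
      refine (H (-1) (-1 + h) (by linarith)).of_subset hε'.le fun x hx hx1 => ⟨(abs_le.1 hx1).1, ?_⟩
      simpa using hx
    | succ k ih =>
      intro ε' hε'
      rcases lt_or_ge (-1 + (k + 1) * h) 1 with hc | hc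
      · have hpos : 0 < ((k : ℝ) + 1) * h := by positivity
        refine Stab.glue (c := -1 + (k + 1) * h) (ε := (ε / 2 + ε') / 2) hn (by linarith) hc ?_
          (ih _ (by linarith)) ((H _ _ ?_).of_subset (by linarith) fun x hx _ => hx) (by linarith)
        · push_cast; linarith
        · push_cast; linarith
      · exact (ih ε' hε').of_subset le_rfl fun x _ hx1 => (abs_le.1 hx1).2.trans hc
  obtain ⟨k, hk⟩ := exists_nat_gt (2 / h)
  rw [div_lt_iff₀ hh] at hk
  refine (key k ε (by linarith)).of_subset le_rfl fun x _ hx1 => ?_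
  have := (abs_le.1 hx1).2
  rw [Set.mem_Iic]
  linarith

end Stability

section Diagonalize

variable {ι : Type} [Fintype ι] [DecidableEq ι]

/-- Unitary matrices are unitarily diagonalisable. -/
theorem exists_diagonalizing_unitary {B : Matrix ι ι ℂ} (hB : B ∈ unitary (Matrix ι ι ℂ)) :
    ∃ Q ∈ unitary (Matrix ι ι ℂ), ∃ β : ι → ℂ, (∀ i, ‖β i‖ = 1) ∧ B = Q * diagonal β * Qᴴ := by
  have hBn : IsStarNormal B := ⟨by
    rw [commute_iff_eq, Unitary.star_mul_self_of_mem hB, Unitary.mul_star_self_of_mem hB]⟩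
  have hcont (f : ℂ → ℂ) : ContinuousOn f (spectrum ℂ B) :=
    (Matrix.finite_spectrum B).continuousOn f
  set H : Matrix ι ι ℂ := cfc (fun z : ℂ => (z.arg : ℂ)) B with hH
  have hHh : H.IsHermitian := by
    change star H = H
    rw [hH, ← cfc_star]
    simp
  have hexp : B = NormedSpace.exp (Complex.I • H) := by
    have h1 : Complex.I • H = cfc (fun z : ℂ => Complex.I * (z.arg : ℂ)) B := by
      rw [cfc_const_mul _ _ _ (hcont _)]
    have h2 : B = cfc (fun z : ℂ => Complex.exp (Complex.I * (z.arg : ℂ))) B := by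
      conv_lhs => rw [← cfc_id ℂ B]
      refine cfc_congr fun z hz => ?_
      have h3 : ‖z‖ = 1 := spectrum.norm_eq_one_of_unitary hB hz
      have h4 := Complex.norm_mul_exp_arg_mul_I z
      rw [h3, Complex.ofReal_one, one_mul] at h4
      simp only [id]
      rw [mul_comm, h4]
    rw [h1]
    conv_lhs => rw [h2]
    rw [cfc_comp' Complex.exp _ B (by fun_prop) (hcont _), CFC.complex_exp_eq_normedSpace_exp]
  set Q : Matrix ι ι ℂ := (hHh.eigenvectorUnitary : Matrix ι ι ℂ) with hQ
  have hQu : Q ∈ unitary (Matrix ι ι ℂ) := hHh.eigenvectorUnitary.2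
  have hQ1 : Qᴴ * Q = 1 := Unitary.star_mul_self_of_mem hQu
  have hQinv : Q⁻¹ = Qᴴ := Matrix.inv_eq_left_inv hQ1
  have hsp : H = Q * diagonal (fun i => (hHh.eigenvalues i : ℂ)) * Qᴴ := hHh.spectral_theorem
  have hsp' : Complex.I • H =
      Q * diagonal (fun i => Complex.I * (hHh.eigenvalues i : ℂ)) * Q⁻¹ := by
    rw [hQinv]
    refine (congrArg (Complex.I • ·) hsp).trans ?_
    rw [← Matrix.smul_mul, ← Matrix.mul_smul, ← diagonal_smul]
    rfl
  refine ⟨Q, hQu, fun i => Complex.exp (Complex.I * (hHh.eigenvalues i : ℂ)), fun i => ?_, ?_⟩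
  · beta_reduce
    rw [mul_comm, Complex.norm_exp_ofReal_mul_I]
  · rw [hexp, hsp', Matrix.exp_conj _ _ ((Matrix.isUnit_iff_isUnit_det _).2
      (isUnit_det_of_left_inverse hQ1)), Matrix.exp_diagonal, hQinv]
    congr 3
    ext i
    rw [Pi.coe_exp, Complex.exp_eq_exp_ℂ]

/-- Almost solutions of the relation in unitaries are stably near exact solutions. -/
theorem exists_nearRep {n : ℕ} (hn : n ≠ 0) {ε : ℝ} (hε : 0 < ε) :
    ∃ δ > 0, ∀ (ι : Type) [Fintype ι] [DecidableEq ι] (A B : Matrix ι ι ℂ),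
      A ∈ unitary (Matrix ι ι ℂ) → B ∈ unitary (Matrix ι ι ℂ) →
      ‖A * B ^ n - Bᴴ ^ n * A‖ ≤ δ → NearRep n ε A B := by
  obtain ⟨δ, hδ, h⟩ := stab_univ hn hε
  refine ⟨δ, hδ, fun ι _ _ A B hA hB hAB => ?_⟩
  obtain ⟨Q, hQ, β, hβ, rfl⟩ := exists_diagonalizing_unitary hB
  have hQ1 : Qᴴ * Q = 1 := Unitary.star_mul_self_of_mem hQ
  have hQ2 : Q * Qᴴ = 1 := Unitary.mul_star_self_of_mem hQ
  have hQ1' : (Qᴴ)ᴴ * Qᴴ = 1 := by rw [conjTranspose_conjTranspose, hQ2]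
  have hQ2' : Qᴴ * (Qᴴ)ᴴ = 1 := by rw [conjTranspose_conjTranspose, hQ1]
  have hA' : Qᴴ * A * Q ∈ unitary (Matrix ι ι ℂ) := conj_mem_unitary hQ2 hQ1 hA
  have hpow : (Q * diagonal β * Qᴴ) ^ n = Q * diagonal (fun i => β i ^ n) * Qᴴ := by
    have := conj_pow_of_isometry hQ2' hQ1' (diagonal β) n
    rw [conjTranspose_conjTranspose, diagonal_pow] at this
    exact this
  have hpow' : (Q * diagonal β * Qᴴ)ᴴ ^ n = Q * diagonal (fun i => star (β i ^ n)) * Qᴴ := by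
    rw [← conjTranspose_pow, hpow, conjTranspose_mul, conjTranspose_mul,
      conjTranspose_conjTranspose, diagonal_conjTranspose, Matrix.mul_assoc]
    rfl
  rw [hpow, hpow'] at hAB
  have hnear := (h ι β _ hA' hβ (fun i => Set.mem_univ _) ?_).conj hQ2' hQ1'
  · rw [conjTranspose_conjTranspose] at hnear
    have h1 : Q * (Qᴴ * A * Q) * Qᴴ = A := by
      calc Q * (Qᴴ * A * Q) * Qᴴ = (Q * Qᴴ) * A * (Q * Qᴴ) := by simp only [Matrix.mul_assoc]
        _ = A := by rw [hQ2, Matrix.one_mul, Matrix.mul_one]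
    rwa [h1] at hnear
  · have h1 : Qᴴ * A * Q * diagonal (fun i => β i ^ n) -
        diagonal (fun i => star (β i ^ n)) * (Qᴴ * A * Q) =
        Qᴴ * (A * (Q * diagonal (fun i => β i ^ n) * Qᴴ) -
          Q * diagonal (fun i => star (β i ^ n)) * Qᴴ * A) * Q := by
      rw [Matrix.mul_sub, Matrix.sub_mul]
      congr 1
      · calc Qᴴ * A * Q * diagonal (fun i => β i ^ n) =
            Qᴴ * A * Q * diagonal (fun i => β i ^ n) * (Qᴴ * Q) := by rw [hQ1, Matrix.mul_one]
          _ = _ := by simp only [Matrix.mul_assoc]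
      · calc diagonal (fun i => star (β i ^ n)) * (Qᴴ * A * Q) =
            (Qᴴ * Q) * (diagonal (fun i => star (β i ^ n)) * (Qᴴ * A * Q)) := by
              rw [hQ1, Matrix.one_mul]
          _ = _ := by simp only [Matrix.mul_assoc]
    rw [h1]
    exact ((norm_mul_le_right _ (norm_unitary_le hQ)).trans
      (norm_mul_le_left (norm_star_unitary_le hQ) _)).trans hAB

end Diagonalize

section Words

/-- A `*`-preserving quasi-representation, on an arbitrary finite index type. -/
def IsStarQuasiRep {Γ : Type*} [Group Γ] (T : Set Γ) (δ : ℝ) {ι : Type} [Fintype ι]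
    [DecidableEq ι] (Φ : Γ → Matrix ι ι ℂ) : Prop :=
  Φ 1 = 1 ∧ (∀ g, ‖Φ g‖ ≤ 1) ∧ (∀ g, Φ g⁻¹ = (Φ g)ᴴ) ∧
    ∀ s ∈ T, ∀ t ∈ T, ‖Φ s * Φ t - Φ (s * t)‖ ≤ δ

theorem IsStarQuasiRep.mono {Γ : Type*} [Group Γ] {T T' : Set Γ} {δ δ' : ℝ} {ι : Type}
    [Fintype ι] [DecidableEq ι] {Φ : Γ → Matrix ι ι ℂ} (h : IsStarQuasiRep T δ Φ) (hT : T' ⊆ T)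
    (hδ : δ ≤ δ') : IsStarQuasiRep T' δ' Φ :=
  ⟨h.1, h.2.1, h.2.2.1, fun s hs t ht => (h.2.2.2 s (hT hs) t (hT ht)).trans hδ⟩

/-- A quasi-representation which is close to a homomorphism on the generators is close to it on
any given word. -/
theorem exists_word_near {Γ α : Type*} [Group Γ] (p : FreeGroup α →* Γ) (w : FreeGroup α) :
    ∀ ε : ℝ, 0 < ε → ∃ (T : Set Γ) (δ : ℝ), T.Finite ∧ 0 < δ ∧
      ∀ (ι : Type) [Fintype ι] [DecidableEq ι] (Φ : Γ → Matrix ι ι ℂ)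
        (ψ : FreeGroup α →* unitary (Matrix ι ι ℂ)), IsStarQuasiRep T δ Φ →
        (∀ i, ‖Φ (p (FreeGroup.of i)) - (ψ (FreeGroup.of i) : Matrix ι ι ℂ)‖ ≤ δ) →
        ‖Φ (p w) - (ψ w : Matrix ι ι ℂ)‖ ≤ ε := by
  induction w using FreeGroup.induction_on with
  | C1 =>
    intro ε hε
    refine ⟨∅, 1, Set.finite_empty, one_pos, fun ι _ _ Φ ψ hΦ _ => ?_⟩
    rw [map_one, map_one, hΦ.1, OneMemClass.coe_one, sub_self, norm_zero]
    exact hε.le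
  | of i =>
    intro ε hε
    exact ⟨∅, ε, Set.finite_empty, hε, fun ι _ _ Φ ψ _ h => h i⟩
  | inv_of i ih =>
    intro ε hε
    obtain ⟨T, δ, hT, hδ, h⟩ := ih ε hε
    refine ⟨T, δ, hT, hδ, fun ι _ _ Φ ψ hΦ hgen => ?_⟩
    have h1 := h ι Φ ψ hΦ hgen
    have h2 : ((ψ (FreeGroup.of i)⁻¹ : unitary (Matrix ι ι ℂ)) : Matrix ι ι ℂ) =
        (ψ (FreeGroup.of i) : Matrix ι ι ℂ)ᴴ := by
      rw [map_inv]; rfl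
    have h3 : Φ (p (FreeGroup.of i)⁻¹) = (Φ (p (FreeGroup.of i)))ᴴ := by
      rw [map_inv, hΦ.2.2.1]
    rw [h2, h3, ← conjTranspose_sub, l2_opNorm_conjTranspose]
    exact h1
  | mul x y ihx ihy =>
    intro ε hε
    obtain ⟨T₁, δ₁, hT₁, hδ₁, h₁⟩ := ihx (ε / 3) (by positivity)
    obtain ⟨T₂, δ₂, hT₂, hδ₂, h₂⟩ := ihy (ε / 3) (by positivity)
    refine ⟨T₁ ∪ T₂ ∪ {p x, p y}, min (min δ₁ δ₂) (ε / 3),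
      (hT₁.union hT₂).union (Set.toFinite _), by positivity, fun ι _ _ Φ ψ hΦ hgen => ?_⟩
    have e₁ := h₁ ι Φ ψ (hΦ.mono (fun t ht => Or.inl (Or.inl ht))
      ((min_le_left _ _).trans (min_le_left _ _)))
      fun i => (hgen i).trans ((min_le_left _ _).trans (min_le_left _ _))
    have e₂ := h₂ ι Φ ψ (hΦ.mono (fun t ht => Or.inl (Or.inr ht))
      ((min_le_left _ _).trans (min_le_right _ _)))
      fun i => (hgen i).trans ((min_le_left _ _).trans (min_le_right _ _))
    have e₃ := (hΦ.2.2.2 (p x) (Or.inr (Or.inl rfl)) (p y) (Or.inr (Or.inr rfl))).trans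
      (min_le_right _ _)
    rw [norm_sub_rev] at e₃
    have e₄ : Φ (p (x * y)) - ((ψ (x * y) : unitary (Matrix ι ι ℂ)) : Matrix ι ι ℂ) =
        (Φ (p x * p y) - Φ (p x) * Φ (p y)) + (Φ (p x) - (ψ x : Matrix ι ι ℂ)) * Φ (p y) +
          (ψ x : Matrix ι ι ℂ) * (Φ (p y) - (ψ y : Matrix ι ι ℂ)) := by
      rw [map_mul, map_mul, Submonoid.coe_mul]
      noncomm_ring
    rw [e₄]
    refine (norm_add₃_le).trans ?_
    have e₅ := (norm_mul_le_right (Φ (p x) - (ψ x : Matrix ι ι ℂ)) (hΦ.2.1 (p y))).trans e₁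
    have e₆ := (norm_mul_le_left (norm_unitary_le (ψ x).2)
      (Φ (p y) - (ψ y : Matrix ι ι ℂ))).trans e₂
    linarith

theorem exists_words_near {Γ α : Type*} [Group Γ] (p : FreeGroup α →* Γ)
    (hp : Function.Surjective p) {S : Set Γ} (hS : S.Finite) {ε : ℝ} (hε : 0 < ε) :
    ∃ (T : Set Γ) (δ : ℝ), T.Finite ∧ 0 < δ ∧
      ∀ (ι : Type) [Fintype ι] [DecidableEq ι] (Φ : Γ → Matrix ι ι ℂ)
        (π : Γ →* unitary (Matrix ι ι ℂ)), IsStarQuasiRep T δ Φ →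
        (∀ i, ‖Φ (p (FreeGroup.of i)) - (π (p (FreeGroup.of i)) : Matrix ι ι ℂ)‖ ≤ δ) →
        ∀ s ∈ S, ‖Φ s - (π s : Matrix ι ι ℂ)‖ ≤ ε := by
  induction S, hS using Set.Finite.induction_on with
  | empty => exact ⟨∅, 1, Set.finite_empty, one_pos, fun _ _ _ _ _ _ _ s hs => absurd hs (by simp)⟩
  | @insert s S _ _ ih =>
    obtain ⟨T₁, δ₁, hT₁, hδ₁, h₁⟩ := ih
    obtain ⟨w, rfl⟩ := hp s
    obtain ⟨T₂, δ₂, hT₂, hδ₂, h₂⟩ := exists_word_near p w ε hε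
    refine ⟨T₁ ∪ T₂, min δ₁ δ₂, hT₁.union hT₂, lt_min hδ₁ hδ₂, fun ι _ _ Φ π hΦ hgen s hs => ?_⟩
    rcases hs with rfl | hs
    · exact h₂ ι Φ (π.comp p) (hΦ.mono Set.subset_union_right (min_le_right _ _))
        fun i => (hgen i).trans (min_le_right _ _)
    · exact h₁ ι Φ π (hΦ.mono Set.subset_union_left (min_le_left _ _))
        (fun i => (hgen i).trans (min_le_left _ _)) s hs

theorem IsStarQuasiRep.blockDiag {Γ : Type*} [Group Γ] {T : Set Γ} {δ : ℝ} (hδ : 0 ≤ δ)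
    {ι κ : Type} [Fintype ι] [DecidableEq ι] [Fintype κ] [DecidableEq κ] {Φ : Γ → Matrix ι ι ℂ}
    (h : IsStarQuasiRep T δ Φ) (θ : Γ →* unitary (Matrix κ κ ℂ)) :
    IsStarQuasiRep T δ fun g => fromBlocks (Φ g) 0 0 (θ g : Matrix κ κ ℂ) := by
  refine ⟨?_, fun g => norm_fromBlocks_diag_le (h.2.1 g) (norm_unitary_le (θ g).2), fun g => ?_,
    fun s hs t ht => ?_⟩
  · beta_reduce
    rw [h.1, map_one, OneMemClass.coe_one, fromBlocks_one]
  · beta_reduce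
    rw [h.2.2.1, fromBlocks_conjTranspose, conjTranspose_zero, conjTranspose_zero, map_inv]
    rfl
  · rw [fromBlocks_multiply]
    simp only [Matrix.mul_zero, Matrix.zero_mul, add_zero, zero_add]
    rw [fromBlocks_diag_sub, map_mul, Submonoid.coe_mul, sub_self]
    exact norm_fromBlocks_diag_le (h.2.2.2 s hs t ht) (by rwa [norm_zero])

end Words

section BaumslagSolitar

theorem IsUcpQuasiRep.map_inv {Γ : Type*} [Group Γ] {m : ℕ}
    {φ : Γ → Matrix (Fin m) (Fin m) ℂ} (h1 : φ 1 = 1) (h : IsUcpQuasiRep φ) (g : Γ) :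
    φ g⁻¹ = (φ g)ᴴ := by
  classical
  by_cases hg : g = 1
  · rw [hg, inv_one, h1, conjTranspose_one]
  have key : ∀ c : ℂ, (1 + c • φ g + (star c • φ g⁻¹ + (star c * c) • 1)).IsHermitian := by
    intro c
    have h2 := (h {1, g} fun x => if x = 1 then 1 else c).isHermitian
    simpa [Finset.sum_pair (Ne.symm hg), hg, h1] using h2
  have e1 := key 1
  have e2 := key Complex.I
  simp only [Matrix.IsHermitian, conjTranspose_add, conjTranspose_smul, conjTranspose_one,
    star_one, one_smul, mul_one, star_star, star_mul] at e1 e2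
  have hI : star Complex.I = -Complex.I := Complex.conj_I
  rw [hI] at e2
  ext i j
  have f1 := congrFun (congrFun e1 i) j
  have f2 := congrFun (congrFun e2 i) j
  simp only [Matrix.add_apply, Matrix.smul_apply, smul_eq_mul] at f1 f2
  have f3 : Complex.I * (-(φ g)ᴴ i j + (φ g⁻¹)ᴴ i j) = Complex.I * (φ g i j - φ g⁻¹ i j) := by
    linear_combination f2
  have f4 := mul_left_cancel₀ Complex.I_ne_zero f3
  linear_combination -(f1 - f4) / 2

/-- The representation of `BS(n,−n)` given by an exact pair of unitaries. -/
theorem IsExactPair.exists_rep {n : ℕ} {κ : Type} [Fintype κ] [DecidableEq κ]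
    {A B : Matrix κ κ ℂ} (h : IsExactPair n A B) :
    ∃ θ : BSnmn n →* unitary (Matrix κ κ ℂ),
      (θ (PresentedGroup.of 0) : Matrix κ κ ℂ) = A ∧
      (θ (PresentedGroup.of 1) : Matrix κ κ ℂ) = B := by
  set f : Fin 2 → unitary (Matrix κ κ ℂ) := ![⟨A, h.1⟩, ⟨B, h.2.1⟩] with hf
  have hrel : ∀ r ∈ ({bsRelator' n} : Set (FreeGroup (Fin 2))), FreeGroup.lift f r = 1 := by
    rintro r rfl
    have h1 : A * Aᴴ = 1 := Unitary.mul_star_self_of_mem h.1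
    have h2 : Bᴴ * B = 1 := Unitary.star_mul_self_of_mem h.2.1
    have h3 : Bᴴ ^ n * B ^ n = 1 := by
      have := Unitary.star_mul_self_of_mem (pow_mem h.2.1 n)
      rwa [star_pow] at this
    apply Subtype.ext
    have h4 : ((FreeGroup.lift f (bsRelator' n) : unitary (Matrix κ κ ℂ)) : Matrix κ κ ℂ) =
        A * B ^ n * Aᴴ * B ^ n := by
      simp [bsRelator', hf, star_eq_conjTranspose]
    rw [h4, h.2.2, Matrix.mul_assoc (Bᴴ ^ n), h1, Matrix.mul_one, h3]
    rfl
  refine ⟨PresentedGroup.toGroup hrel, ?_, ?_⟩ <;> rw [PresentedGroup.toGroup.of] <;> rfl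

theorem IsStarQuasiRep.exists_unitary {Γ : Type*} [Group Γ] {T : Set Γ} {δ : ℝ} {ι : Type}
    [Fintype ι] [DecidableEq ι] {Φ : Γ → Matrix ι ι ℂ} (h : IsStarQuasiRep T δ Φ)
    (hδ : δ ≤ 1 / 2) {g : Γ} (hg : g ∈ T) (hg' : g⁻¹ ∈ T) :
    ∃ U ∈ unitary (Matrix ι ι ℂ), ‖Φ g - U‖ ≤ δ := by
  have h1 : ‖(Φ g)ᴴ * Φ g - 1‖ ≤ δ := by
    have := h.2.2.2 _ hg' _ hg
    rwa [h.2.2.1, inv_mul_cancel, h.1] at this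
  obtain ⟨U, hU, hU1, -⟩ := exists_unitary_near (Φ g) (0 : Matrix ι ι ℂ) (conjTranspose_zero)
    (h1.trans hδ) (by rw [Matrix.zero_mul, Matrix.mul_zero, neg_zero])
  exact ⟨U, hU, by rw [norm_sub_rev]; exact hU1.trans h1⟩

theorem exists_unitary_reps {n : ℕ} (hn : n ≠ 0) {S : Set (BSnmn n)} (hS : S.Finite) {ε : ℝ}
    (hε : 0 < ε) :
    ∃ (T : Set (BSnmn n)) (δ : ℝ), T.Finite ∧ 0 < δ ∧
      ∀ (ι : Type) [Fintype ι] [DecidableEq ι] (Φ : BSnmn n → Matrix ι ι ℂ),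
        IsStarQuasiRep T δ Φ →
        ∃ (κ : Type) (_ : Fintype κ) (_ : DecidableEq κ) (θ : BSnmn n →* unitary (Matrix κ κ ℂ))
          (π : BSnmn n →* unitary (Matrix (ι ⊕ κ) (ι ⊕ κ) ℂ)),
          ∀ s ∈ S, ‖fromBlocks (Φ s) 0 0 (θ s : Matrix κ κ ℂ) -
            (π s : Matrix (ι ⊕ κ) (ι ⊕ κ) ℂ)‖ ≤ ε := by
  set p : FreeGroup (Fin 2) →* BSnmn n := PresentedGroup.mk _ with hp
  obtain ⟨T₀, δ₀, hT₀, hδ₀, h₀⟩ := exists_words_near p (PresentedGroup.mk_surjective _) hS hε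
  obtain ⟨δ₁, hδ₁, h₁⟩ := exists_nearRep hn (half_pos hδ₀)
  obtain ⟨T₂, δ₂, hT₂, hδ₂, h₂⟩ := exists_word_near p (bsRelator' n) δ₁ hδ₁
  set a : BSnmn n := PresentedGroup.of 0 with ha
  set b : BSnmn n := PresentedGroup.of 1 with hb
  set δ := min (min (δ₀ / 2) δ₂) (1 / 2) with hδ
  have hd0 : δ ≤ δ₀ / 2 := (min_le_left _ _).trans (min_le_left _ _)
  have hd2 : δ ≤ δ₂ := (min_le_left _ _).trans (min_le_right _ _)
  refine ⟨T₀ ∪ T₂ ∪ {a, a⁻¹, b, b⁻¹}, δ, (hT₀.union hT₂).union (Set.toFinite _), by positivity,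
    fun ι _ _ Φ hΦ => ?_⟩
  obtain ⟨A, hA, hAΦ⟩ := hΦ.exists_unitary (g := a) (min_le_right _ _) (by simp) (by simp)
  obtain ⟨B, hB, hBΦ⟩ := hΦ.exists_unitary (g := b) (min_le_right _ _) (by simp) (by simp)
  have hnear : NearRep n δ₀ (Φ a) (Φ b) := by
    have hAB : ‖A * B ^ n - Bᴴ ^ n * A‖ ≤ δ₁ := by
      set f : Fin 2 → unitary (Matrix ι ι ℂ) := ![⟨A, hA⟩, ⟨B, hB⟩] with hf
      have e1 := h₂ ι Φ (FreeGroup.lift f)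
        (hΦ.mono (fun t ht => Or.inl (Or.inr ht)) hd2) (by
          intro i
          rw [FreeGroup.lift_apply_of]
          fin_cases i
          · exact hAΦ.trans hd2
          · exact hBΦ.trans hd2)
      have e2 : p (bsRelator' n) = 1 := PresentedGroup.one_of_mem rfl
      have e3 : ((FreeGroup.lift f (bsRelator' n) : unitary (Matrix ι ι ℂ)) : Matrix ι ι ℂ) =
          A * B ^ n * Aᴴ * B ^ n := by
        simp [bsRelator', hf, star_eq_conjTranspose]
      rw [e2, hΦ.1, e3] at e1
      have f1 : Aᴴ * A = 1 := Unitary.star_mul_self_of_mem hA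
      have f2 : B ^ n * Bᴴ ^ n = 1 := by
        have := Unitary.mul_star_self_of_mem (pow_mem hB n)
        rwa [star_pow] at this
      have f3 : A * B ^ n - Bᴴ ^ n * A = -((1 - A * B ^ n * Aᴴ * B ^ n) * (Bᴴ ^ n * A)) := by
        have : A * B ^ n * Aᴴ * B ^ n * (Bᴴ ^ n * A) = A * B ^ n := by
          calc A * B ^ n * Aᴴ * B ^ n * (Bᴴ ^ n * A) =
              A * B ^ n * Aᴴ * (B ^ n * Bᴴ ^ n) * A := by simp only [Matrix.mul_assoc]
            _ = A * B ^ n * (Aᴴ * A) := by rw [f2, Matrix.mul_one, Matrix.mul_assoc]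
            _ = _ := by rw [f1, Matrix.mul_one]
        rw [Matrix.sub_mul, this, Matrix.one_mul, neg_sub]
      rw [f3, norm_neg]
      refine (norm_mul_le_right _ (norm_unitary_le ?_)).trans e1
      exact mul_mem (pow_mem (Unitary.star_mem hB) n) hA
    have := (h₁ ι A B hA hB hAB).perturb (half_pos hδ₀).le (hAΦ.trans hd0) (hBΦ.trans hd0)
    rwa [add_halves] at this
  obtain ⟨κ, _, _, A₁, B₁, A₂, B₂, hE₁, hE₂, hA₂, hB₂⟩ := hnear
  obtain ⟨θ, hθa, hθb⟩ := hE₁.exists_rep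
  obtain ⟨π, hπa, hπb⟩ := hE₂.exists_rep
  refine ⟨κ, _, _, θ, π, h₀ (ι ⊕ κ) _ π ((hΦ.mono (fun t ht => Or.inl (Or.inl ht))
    (hd0.trans (half_le_self hδ₀.le))).blockDiag hδ₀.le θ) fun i => ?_⟩
  fin_cases i
  · change ‖fromBlocks (Φ a) 0 0 (θ a : Matrix κ κ ℂ) - (π a : Matrix (ι ⊕ κ) (ι ⊕ κ) ℂ)‖ ≤ δ₀
    rw [hθa, hπa]
    exact hA₂
  · change ‖fromBlocks (Φ b) 0 0 (θ b : Matrix κ κ ℂ) - (π b : Matrix (ι ⊕ κ) (ι ⊕ κ) ℂ)‖ ≤ δ₀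
    rw [hθb, hπb]
    exact hB₂

theorem isUnitaryRep_submatrix {Γ : Type*} [Group Γ] {κ : Type} [Fintype κ] [DecidableEq κ]
    {k : ℕ} (e : κ ≃ Fin k) (θ : Γ →* unitary (Matrix κ κ ℂ)) :
    IsUnitaryRep fun g => (θ g : Matrix κ κ ℂ).submatrix e.symm e.symm := by
  refine ⟨?_, fun x y => ?_, fun x => submatrix_mem_unitary e (θ x).2⟩
  · beta_reduce
    rw [map_one, OneMemClass.coe_one, submatrix_one_equiv]
  · beta_reduce
    rw [map_mul, Submonoid.coe_mul, submatrix_mul_equiv]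

end BaumslagSolitar

/-- The Baumslag–Solitar group `BS(n,−n)` is weakly ucp stable. -/
theorem statement16 (n : ℕ) (hn : 1 ≤ n)
    (S : Set (BSnmn n)) (hS : S.Finite) (ε : ℝ) (hε : 0 < ε) :
    ∃ (T : Set (BSnmn n)) (δ : ℝ), T.Finite ∧ 0 < δ ∧
      ∀ (m : ℕ), 1 ≤ m → ∀ φ : BSnmn n → Matrix (Fin m) (Fin m) ℂ,
        IsQuasiRep T δ φ → IsUcpQuasiRep φ →
        ∃ (k : ℕ) (θ : BSnmn n → Matrix (Fin k) (Fin k) ℂ)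
          (π : BSnmn n → Matrix (Fin (m + k)) (Fin (m + k)) ℂ),
          IsUnitaryRep θ ∧ IsUnitaryRep π ∧
          ∀ s ∈ S, ‖blockSum (φ s) (θ s) - π s‖ < ε := by
  obtain ⟨T, δ, hT, hδ, h⟩ := exists_unitary_reps (Nat.one_le_iff_ne_zero.1 hn) hS (half_pos hε)
  refine ⟨T, δ, hT, hδ, fun m _ φ hφ hucp => ?_⟩
  obtain ⟨κ, _, _, θ, π, hθπ⟩ := h (Fin m) φ
    ⟨hφ.1, hφ.2.1, hucp.map_inv hφ.1, fun s hs t ht => (hφ.2.2 s hs t ht).le⟩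
  set e := Fintype.equivFin κ with he
  set f := (Equiv.sumCongr (Equiv.refl (Fin m)) e).trans finSumFinEquiv with hf
  refine ⟨Fintype.card κ, _, _, isUnitaryRep_submatrix e θ, isUnitaryRep_submatrix f π,
    fun s hs => ?_⟩
  have h1 : blockSum (φ s) ((θ s : Matrix κ κ ℂ).submatrix e.symm e.symm) =
      (Matrix.fromBlocks (φ s) 0 0 (θ s : Matrix κ κ ℂ)).submatrix f.symm f.symm := by
    ext i j
    obtain ⟨i, rfl⟩ := finSumFinEquiv.surjective i
    obtain ⟨j, rfl⟩ := finSumFinEquiv.surjective j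
    rcases i with i | i <;> rcases j with j | j <;> simp [blockSum, hf]
  rw [h1, ← submatrix_equiv_sub]
  exact ((norm_submatrix_le f _).trans (hθπ s hs)).trans_lt (half_lt_self hε)

end
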